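/- Let S ⊂ ℤ be a finite nonempty set with S = −S and such that s+t ∉ S for all s,t ∈ ℕ∖S, and let m = max(S). Then the face generating function satisfies F_S(x,u) = Σ_{(T,μ) ∈ ŌT(S)} u^{#blocks(μ)} · x^{|T|}/|T|!, where ŌT(S) := ⋃_{n≥0} ŌT_m^n(A_S^n), |T| is the number of nodes of T, and #blocks(μ) is the number of blocks of (T,μ). -/

import Mathlib

open scoped BigOperators Classical

namespace Braid

/-- The hyperplane `{x ∈ ℝ^n | x i - x j = s}`. -/
def hyp (n : ℕ) (i j : Fin n) (s : ℝ) : Set (Fin n → ℝ) := {x | x i - x j = s}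

/-- The arrangement `A_S^n`, as a set of hyperplanes. -/
def arrS (S : Set ℤ) (n : ℕ) : Set (Set (Fin n → ℝ)) :=
  {H | ∃ i j : Fin n, ∃ s : ℤ, i < j ∧ s ∈ S ∧ H = hyp n i j (s : ℝ)}

/-- The `m`-Catalan arrangement `A_m^n = A_{[-m;m]}^n`. -/
def catArr (m n : ℕ) : Set (Set (Fin n → ℝ)) := arrS {s : ℤ | s.natAbs ≤ m} n

/-- `(i,j,s) ∈ Tr_m^n`. -/
def TrIdx (m n : ℕ) (i j : Fin n) (s : ℕ) : Prop := s ≤ m ∧ i ≠ j ∧ (0 < s ∨ j < i)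

/-- `(i,j,s) ∈ Tr_m^n(A)`. -/
def TrIdxA (m n : ℕ) (A : Set (Set (Fin n → ℝ))) (i j : Fin n) (s : ℕ) : Prop :=
  TrIdx m n i j s ∧ hyp n i j (s : ℝ) ∈ A

/-- A transitive arrangement `A ⊆ A_m^n`. -/
def IsTransitive (m n : ℕ) (A : Set (Set (Fin n → ℝ))) : Prop :=
  ∀ i j k : Fin n, i ≠ j → j ≠ k → i ≠ k → ∀ s t : ℕ,
    TrIdx m n i j s → TrIdx m n j k t →
    hyp n i j (s : ℝ) ∉ A → hyp n j k (t : ℝ) ∉ A → hyp n i k ((s : ℝ) + (t : ℝ)) ∉ A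

/-- A strongly transitive arrangement. -/
def IsStronglyTransitive (n : ℕ) (A : Set (Set (Fin n → ℝ))) : Prop :=
  ∀ i j k : Fin n, i ≠ j → j ≠ k → i ≠ k → ∀ s t : ℕ,
    hyp n i j (s : ℝ) ∉ A → hyp n j k (t : ℝ) ∉ A → hyp n i k ((s : ℝ) + (t : ℝ)) ∉ A

/-- An `(m,n)`-tree: a rooted `(m+1)`-ary tree with `n` nodes labeled by `Fin n`
(leaves unlabeled), encoded by the root-to-node lists of child indices. -/
structure Tree (m n : ℕ) where
  path : Fin n → List ℕ
  entry_le : ∀ v : Fin n, ∀ s ∈ path v, s ≤ m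
  inj : Function.Injective path
  parent_closed : ∀ v : Fin n, path v ≠ [] → ∃ w : Fin n, path w = (path v).dropLast

namespace Tree

variable {m n : ℕ}

/-- The drift of a node. -/
def drift (T : Tree m n) (v : Fin n) : ℕ := (T.path v).sum

/-- `i = s`-child`(j)`. -/
def IsChild (T : Tree m n) (i j : Fin n) (s : ℕ) : Prop := T.path i = T.path j ++ [s]

/-- The `s`-child slot of node `j` is occupied by a node (not a leaf). -/
def SlotNode (T : Tree m n) (j : Fin n) (s : ℕ) : Prop := ∃ i, T.IsChild i j s

/-- `i = s`-cadet`(j)`. -/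
def IsCadet (T : Tree m n) (i j : Fin n) (s : ℕ) : Prop :=
  T.IsChild i j s ∧ ∀ t : ℕ, s < t → t ≤ m → ¬ T.SlotNode j t

end Tree

/-- The order `≺_T` on vertices of a tree, expressed on root-to-vertex paths:
`v ≺_T w` iff `drift(v) < drift(w)`, or the drifts are equal and there is `c ≤ k`
(`k` the length of the path of `v`) with the first `c` entries of both paths equal and
(`c = k` or the entry of the path of `v` at position `c+1` is larger than that of `w`). -/
def vlt (p q : List ℕ) : Prop :=
  p.sum < q.sum ∨
    (p.sum = q.sum ∧ ∃ c ≤ p.length, p.take c = q.take c ∧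
      (c = p.length ∨ ∃ (h1 : c < p.length) (h2 : c < q.length), q.get ⟨c, h2⟩ < p.get ⟨c, h1⟩))

/-- `p ≽_T q`. -/
def vge (p q : List ℕ) : Prop := vlt q p ∨ p = q

/-- A valid marking: `μ` is the set of (lower endpoints of) marked edges; each marked
edge is a cadet edge, and marked `0`-cadet edges `{j, 0cadet(j)}` satisfy `j < 0cadet(j)`. -/
def IsMarking {m n : ℕ} (T : Tree m n) (μ : Set (Fin n)) : Prop :=
  ∀ i ∈ μ, ∃ j s, T.IsCadet i j s ∧ (s = 0 → (j : ℕ) < (i : ℕ))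

/-- The relation `i ∼_μ j`: all edges on the tree path between `i` and `j` are marked. -/
def simMu {m n : ℕ} (T : Tree m n) (μ : Set (Fin n)) : Fin n → Fin n → Prop :=
  Relation.ReflTransGen (fun a b =>
    (a ∈ μ ∧ ∃ s, T.IsChild a b s) ∨ (b ∈ μ ∧ ∃ s, T.IsChild b a s))

/-- The block containing node `i`. -/
def blockOf {m n : ℕ} (T : Tree m n) (μ : Set (Fin n)) (i : Fin n) : Set (Fin n) :=
  {j | simMu T μ i j}

/-- The set of blocks of a marked tree. -/
def blocksOf {m n : ℕ} (T : Tree m n) (μ : Set (Fin n)) : Set (Set (Fin n)) :=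
  {B | ∃ i, B = blockOf T μ i}

/-- The block `B` is `A`-connected. -/
def BlockConnected {m n : ℕ} (A : Set (Set (Fin n → ℝ))) (T : Tree m n)
    (B : Set (Fin n)) : Prop :=
  ∀ i ∈ B, ∀ j ∈ B, Relation.ReflTransGen
    (fun a b => a ∈ B ∧ b ∈ B ∧ hyp n a b ((T.drift a : ℝ) - (T.drift b : ℝ)) ∈ A) i j

/-- The marked tree `(T,μ)` is `A`-connected. -/
def AConnected {m n : ℕ} (A : Set (Set (Fin n → ℝ))) (T : Tree m n)
    (μ : Set (Fin n)) : Prop :=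
  ∀ B ∈ blocksOf T μ, BlockConnected A T B

/-- The `A`-cadet condition. -/
def CadetCond {m n : ℕ} (A : Set (Set (Fin n → ℝ))) (T : Tree m n)
    (μ : Set (Fin n)) : Prop :=
  ∀ i j s, T.IsCadet i j s → i ∉ μ →
    ((s = 0 ∧ (i : ℕ) < (j : ℕ)) ∨
      ∃ i' j', simMu T μ i i' ∧ simMu T μ j j' ∧
        hyp n i' j' ((T.drift i' : ℝ) - (T.drift j' : ℝ)) ∈ A)

/-- The set `ŌT_m^n` of all marked `(m,n)`-trees. -/
def OTall (m n : ℕ) : Set (Tree m n × Set (Fin n)) := {p | IsMarking p.1 p.2}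

/-- The set `ŌT_m^n(A)`. -/
def OTset (m n : ℕ) (A : Set (Set (Fin n → ℝ))) : Set (Tree m n × Set (Fin n)) :=
  {p | IsMarking p.1 p.2 ∧ AConnected A p.1 p.2 ∧ CadetCond A p.1 p.2}

/-- The set `T_m^n(A)` of (unmarked) trees. -/
def Tset (m n : ℕ) (A : Set (Set (Fin n → ℝ))) : Set (Tree m n) :=
  {T | ∀ i j s, TrIdx m n i j s → hyp n i j (s : ℝ) ∉ A → ¬ T.IsCadet i j s}

/-- The region `Φ_A(T)`. -/
def Phi (m n : ℕ) (A : Set (Set (Fin n → ℝ))) (T : Tree m n) : Set (Fin n → ℝ) :=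
  {x | ∀ i j : Fin n, ∀ s : ℕ, TrIdxA m n A i j s →
        (vlt (T.path i) (T.path j ++ [s]) → x i - x j < (s : ℝ)) ∧
        (vge (T.path i) (T.path j ++ [s]) → (s : ℝ) < x i - x j)}

/-- The polyhedron `Φ̄_A(T,μ)`. -/
def PhiBar (m n : ℕ) (A : Set (Set (Fin n → ℝ))) (T : Tree m n) (μ : Set (Fin n)) :
    Set (Fin n → ℝ) :=
  {x | (∀ i ∈ μ, ∀ j s, T.IsChild i j s → x i - x j = (s : ℝ)) ∧
       ∀ i j : Fin n, ∀ s : ℕ, TrIdxA m n A i j s → ¬ simMu T μ i j →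
         (vlt (T.path i) (T.path j ++ [s]) → x i - x j < (s : ℝ)) ∧
         (vge (T.path i) (T.path j ++ [s]) → (s : ℝ) < x i - x j)}

/-- `R` is a region of `A`: a connected component of the complement of the union of `A`. -/
def IsRegion (n : ℕ) (A : Set (Set (Fin n → ℝ))) (R : Set (Fin n → ℝ)) : Prop :=
  ∃ x ∈ (⋃₀ A)ᶜ, R = connectedComponentIn (⋃₀ A)ᶜ x

/-- `σ` is the hyperplane `H` itself or one of the two open half-spaces bounded by `H`. -/
def IsSideOf (n : ℕ) (σ H : Set (Fin n → ℝ)) : Prop :=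
  σ = H ∨ ∃ (i j : Fin n) (s : ℝ), H = hyp n i j s ∧
    (σ = {x | x i - x j < s} ∨ σ = {x | s < x i - x j})

/-- `F` is a face of the arrangement `A`. -/
def IsFace (n : ℕ) (A : Set (Set (Fin n → ℝ))) (F : Set (Fin n → ℝ)) : Prop :=
  F.Nonempty ∧ ∃ σ : Set (Fin n → ℝ) → Set (Fin n → ℝ),
    (∀ H ∈ A, IsSideOf n (σ H) H) ∧ F = ⋂ H ∈ A, σ H

/-- The dimension of (the affine hull of) a subset of `ℝ^n`. -/
noncomputable def faceDim (n : ℕ) (F : Set (Fin n → ℝ)) : ℕ :=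
  Module.finrank ℝ (affineSpan ℝ F).direction

/-- The number `c_{n,k}` of `k`-dimensional faces of `A_S^n`. -/
noncomputable def faceCount (S : Set ℤ) (n k : ℕ) : ℕ :=
  Nat.card {F : Set (Fin n → ℝ) // IsFace n (arrS S n) F ∧ faceDim n F = k}

/-- The face generating function `F_S(x,u) ∈ ℚ[u][[x]]`. -/
noncomputable def FGF (S : Set ℤ) : PowerSeries (Polynomial ℚ) :=
  PowerSeries.mk fun n => Polynomial.C ((n.factorial : ℚ)⁻¹) *
    ∑ k ∈ Finset.range (n + 1), (faceCount S n k : ℚ) • Polynomial.X ^ k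

/-- `e^x` in `ℚ[u][[x]]`. -/
noncomputable def Eexp : PowerSeries (Polynomial ℚ) :=
  PowerSeries.mk fun n => Polynomial.C ((n.factorial : ℚ)⁻¹)

/-- `e^{-x}` in `ℚ[u][[x]]`. -/
noncomputable def EexpNeg : PowerSeries (Polynomial ℚ) :=
  PowerSeries.mk fun n => Polynomial.C ((-1 : ℚ) ^ n * (n.factorial : ℚ)⁻¹)

/-- The variable `u`, as a constant of `ℚ[u][[x]]`. -/
noncomputable def Useries : PowerSeries (Polynomial ℚ) :=
  PowerSeries.C (R := Polynomial ℚ) Polynomial.X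

/-- `e^{xu}` in `ℚ[u][[x]]`. -/
noncomputable def Eexu : PowerSeries (Polynomial ℚ) :=
  PowerSeries.mk fun n => ((n.factorial : ℚ)⁻¹) • Polynomial.X ^ n

/-- `e^{-xu}` in `ℚ[u][[x]]`. -/
noncomputable def EexuNeg : PowerSeries (Polynomial ℚ) :=
  PowerSeries.mk fun n => ((-1 : ℚ) ^ n * (n.factorial : ℚ)⁻¹) • Polynomial.X ^ n

/-! ### The order on slots attached to a point -/

/-- Slot `(j,s)` comes before slot `(k,t)` at the point `x`. -/
def slt {n : ℕ} (x : Fin n → ℝ) (j : Fin n) (s : ℕ) (k : Fin n) (t : ℕ) : Prop :=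
  x j + s < x k + t ∨ (x j + s = x k + t ∧ (x j < x k ∨ (x j = x k ∧ j < k)))

section slots
variable {m n : ℕ} {x y z : Fin n → ℝ}

theorem slt_irrefl (j : Fin n) (s : ℕ) : ¬ slt x j s j s := by
  unfold slt; simp

theorem slt_trans {a b c : Fin n} {r s t : ℕ} (h1 : slt x a r b s) (h2 : slt x b s c t) :
    slt x a r c t := by
  unfold slt at *
  rcases h1 with h1 | ⟨h1, h1'⟩
  · left
    rcases h2 with h2 | ⟨h2, h2'⟩ <;> linarith
  · rcases h2 with h2 | ⟨h2, h2'⟩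
    · left; linarith
    · right
      refine ⟨h1.trans h2, ?_⟩
      rcases h1' with h | ⟨h, h'⟩
      · left
        rcases h2' with k | ⟨k, k'⟩ <;> linarith
      · rcases h2' with k | ⟨k, k'⟩
        · left; linarith
        · right; exact ⟨h.trans k, h'.trans k'⟩

theorem slt_total (a b : Fin n) (r s : ℕ) :
    slt x a r b s ∨ (a = b ∧ r = s) ∨ slt x b s a r := by
  unfold slt
  rcases lt_trichotomy (x a + r) (x b + s) with h | h | h
  · exact Or.inl (Or.inl h)
  · rcases lt_trichotomy (x a) (x b) with h' | h' | h'
    · exact Or.inl (Or.inr ⟨h, Or.inl h'⟩)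
    · rcases lt_trichotomy a b with h'' | h'' | h''
      · exact Or.inl (Or.inr ⟨h, Or.inr ⟨h', h''⟩⟩)
      · right; left
        refine ⟨h'', ?_⟩
        have : (r : ℝ) = s := by linarith
        exact_mod_cast this
      · exact Or.inr (Or.inr (Or.inr ⟨h.symm, Or.inr ⟨h'.symm, h''⟩⟩))
    · exact Or.inr (Or.inr (Or.inr ⟨h.symm, Or.inl h'⟩))
  · exact Or.inr (Or.inr (Or.inl h))

theorem slt_asymm {a b : Fin n} {r s : ℕ} (h1 : slt x a r b s) : ¬ slt x b s a r :=
  fun h2 => slt_irrefl _ _ (slt_trans h1 h2)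

theorem slt_add (a b : Fin n) (r s t : ℕ) : slt x a (r + t) b (s + t) ↔ slt x a r b s := by
  unfold slt
  push_cast
  constructor
  · rintro (h | ⟨h, h'⟩)
    · left; linarith
    · right; exact ⟨by linarith, h'⟩
  · rintro (h | ⟨h, h'⟩)
    · left; linarith
    · right; exact ⟨by linarith, h'⟩

theorem slt_sub_left {a b : Fin n} {r s : ℕ} (h : s ≤ r) : slt x a r b s ↔ slt x a (r - s) b 0 := by
  obtain ⟨d, rfl⟩ := Nat.exists_eq_add_of_le h
  have := slt_add (x := x) a b d 0 s
  rw [Nat.add_comm d s, Nat.zero_add] at this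
  rw [this]; simp

theorem slt_sub_right {a b : Fin n} {r s : ℕ} (h : r ≤ s) : slt x a r b s ↔ slt x a 0 b (s - r) := by
  obtain ⟨d, rfl⟩ := Nat.exists_eq_add_of_le h
  have := slt_add (x := x) a b 0 d r
  rw [Nat.add_comm d r, Nat.zero_add] at this
  rw [this]; simp

theorem slt_le {a b : Fin n} {r s : ℕ} (h : slt x a r b s) : x a + r ≤ x b + s := by
  rcases h with h | h
  · exact h.le
  · exact h.1.le

theorem slt_zero_le {a b : Fin n} {r : ℕ} (h : slt x a r b 0) : x a + r ≤ x b := by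
  simpa using slt_le h

/-- If the tie is allowed. -/
theorem slt_of_le {a b : Fin n} {r : ℕ} (h : x a + r ≤ x b) (hr : 0 < r ∨ a < b) :
    slt x a r b 0 := by
  unfold slt
  rcases h.lt_or_eq with h | h
  · left; simpa using h
  · right
    refine ⟨by simpa using h, ?_⟩
    rcases Nat.eq_zero_or_pos r with h0 | h0
    · subst h0
      rcases hr with hr | hr
      · omega
      · right; exact ⟨by simpa using h, hr⟩
    · left
      have : (0 : ℝ) < r := by exact_mod_cast h0
      linarith

theorem slt_tie {a b : Fin n} {r : ℕ} (h : slt x a r b 0) (he : x b = x a + r) :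
    0 < r ∨ a < b := by
  rcases Nat.eq_zero_or_pos r with h0 | h0
  · subst h0
    right
    rcases h with h | ⟨h, h' | h'⟩
    · simp at h he; linarith
    · simp at h he; linarith
    · exact h'.2
  · exact Or.inl h0

/-- Compatibility of a tree with a point: the slot occupied by a node is its predecessor. -/
structure Comp (T : Tree m n) (x : Fin n → ℝ) : Prop where
  root : ∀ i, T.path i = [] → ∀ j s, s ≤ m → ¬ slt x j s i 0
  lt : ∀ i j s, T.IsChild i j s → slt x j s i 0
  max : ∀ i j s, T.IsChild i j s → ∀ k t, t ≤ m → slt x k t i 0 → ¬ slt x j s k t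

/-- The marks of a tree at a point. -/
def marks (T : Tree m n) (x : Fin n → ℝ) : Set (Fin n) :=
  {i | ∃ j s, T.IsChild i j s ∧ x i = x j + s}

theorem child_le {T : Tree m n} {i j : Fin n} {s : ℕ} (h : T.IsChild i j s) : s ≤ m :=
  T.entry_le i s (by rw [h]; simp)

theorem child_len {T : Tree m n} {i j : Fin n} {s : ℕ} (h : T.IsChild i j s) :
    (T.path i).length = (T.path j).length + 1 := by rw [h]; simp

theorem exists_parent (T : Tree m n) (i : Fin n) (h : T.path i ≠ []) :
    ∃ j s, T.IsChild i j s := by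
  obtain ⟨w, hw⟩ := T.parent_closed i h
  refine ⟨w, (T.path i).getLast h, ?_⟩
  unfold Tree.IsChild
  rw [hw, List.dropLast_append_getLast]

theorem child_unique {T : Tree m n} {i j j' : Fin n} {s s' : ℕ} (h : T.IsChild i j s)
    (h' : T.IsChild i j' s') : j = j' ∧ s = s' := by
  unfold Tree.IsChild at *
  rw [h] at h'
  have := List.append_inj' h' (by simp)
  exact ⟨T.inj this.1, by simpa using this.2⟩

theorem child_inj {T : Tree m n} {i i' j : Fin n} {s : ℕ} (h : T.IsChild i j s)
    (h' : T.IsChild i' j s) : i = i' := T.inj (h.trans h'.symm)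

theorem Comp.lt_child_iff {T : Tree m n} (hT : Comp T x) {b p : Fin n} {q : ℕ}
    (h : T.IsChild b p q) {a : Fin n} {r : ℕ} (hr : r ≤ m) :
    slt x a r b 0 ↔ (a = p ∧ r = q) ∨ slt x a r p q := by
  constructor
  · intro h1
    rcases slt_total (x := x) a p r q with h2 | h2 | h2
    · exact Or.inr h2
    · exact Or.inl h2
    · exact absurd h2 (hT.max b p q h a r hr h1)
  · rintro (⟨rfl, rfl⟩ | h1)
    · exact hT.lt _ _ _ h
    · exact slt_trans h1 (hT.lt _ _ _ h)

theorem Comp.order_unique {T : Tree m n} (hx : Comp T x) (hz : Comp T z) :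
    ∀ (N : ℕ) (a b : Fin n) (r : ℕ), r ≤ m → (T.path a).length + (T.path b).length ≤ N →
      (slt x a r b 0 ↔ slt z a r b 0) := by
  intro N
  induction N with
  | zero =>
    intro a b r hr hN
    have hb : T.path b = [] := List.length_eq_zero_iff.mp (by omega)
    exact iff_of_false (hx.root b hb a r hr) (hz.root b hb a r hr)
  | succ N ih =>
    intro a b r hr hN
    by_cases hb : T.path b = []
    · exact iff_of_false (hx.root b hb a r hr) (hz.root b hb a r hr)
    obtain ⟨p, q, hpq⟩ := exists_parent T b hb
    have hq := child_le hpq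
    have hlen := child_len hpq
    rw [hx.lt_child_iff hpq hr, hz.lt_child_iff hpq hr]
    refine or_congr Iff.rfl ?_
    rcases le_total q r with h | h
    · rw [slt_sub_left h, slt_sub_left h]
      exact ih _ _ _ (by omega) (by omega)
    · have key : slt x p q a r ↔ slt z p q a r := by
        rw [slt_sub_left h, slt_sub_left h]
        exact ih _ _ _ (by omega) (by omega)
      have tx := slt_total (x := x) a p r q
      have tz := slt_total (x := z) a p r q
      constructor
      · intro h1
        rcases tz with h2 | h2 | h2
        · exact h2
        · obtain ⟨rfl, rfl⟩ := h2
          exact absurd h1 (slt_irrefl _ _)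
        · exact absurd (key.mpr h2) (slt_asymm h1)
      · intro h1
        rcases tx with h2 | h2 | h2
        · exact h2
        · obtain ⟨rfl, rfl⟩ := h2
          exact absurd h1 (slt_irrefl _ _)
        · exact absurd (key.mp h2) (slt_asymm h1)

theorem Comp.order_eq {T : Tree m n} (hx : Comp T x) (hz : Comp T z) (a b : Fin n) (r : ℕ)
    (hr : r ≤ m) : slt x a r b 0 ↔ slt z a r b 0 :=
  hx.order_unique hz _ a b r hr le_rfl

theorem tree_ext {T T' : Tree m n} (h : T.path = T'.path) : T = T' := by
  cases T; cases T'; cases h; rfl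

theorem Comp.tree_unique {T T' : Tree m n} (h : Comp T x) (h' : Comp T' x) : T = T' := by
  apply tree_ext
  have : ∀ (N : ℕ) i, (T.path i).length ≤ N → T.path i = T'.path i := by
    intro N
    induction N with
    | zero =>
      intro i hi
      have hb : T.path i = [] := List.length_eq_zero_iff.mp (by omega)
      by_contra hne
      have hb' : T'.path i ≠ [] := fun h0 => hne (hb.trans h0.symm)
      obtain ⟨p, q, hpq⟩ := exists_parent T' i hb'
      exact h.root i hb p q (child_le hpq) (h'.lt _ _ _ hpq)
    | succ N ih =>
      intro i hi
      by_cases hb : T.path i = []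
      · by_contra hne
        have hb' : T'.path i ≠ [] := fun h0 => hne (hb.trans h0.symm)
        obtain ⟨p, q, hpq⟩ := exists_parent T' i hb'
        exact h.root i hb p q (child_le hpq) (h'.lt _ _ _ hpq)
      · obtain ⟨p, q, hpq⟩ := exists_parent T i hb
        have hb' : T'.path i ≠ [] := fun h0 =>
          h'.root i h0 p q (child_le hpq) (h.lt _ _ _ hpq)
        obtain ⟨p', q', hpq'⟩ := exists_parent T' i hb'
        have hlen := child_len hpq
        have e : p = p' ∧ q = q' := by
          rcases slt_total (x := x) p p' q q' with h1 | h1 | h1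
          · exact absurd h1 (h.max _ _ _ hpq _ _ (child_le hpq') (h'.lt _ _ _ hpq'))
          · exact h1
          · exact absurd h1 (h'.max _ _ _ hpq' _ _ (child_le hpq) (h.lt _ _ _ hpq))
        obtain ⟨rfl, rfl⟩ := e
        rw [hpq, hpq', ih p (by omega)]
  funext i
  exact this _ i le_rfl

theorem wf_slt (x : Fin n → ℝ) : WellFounded (fun a b : Fin n => slt x a 0 b 0) := by
  have : IsTrans (Fin n) (fun a b => slt x a 0 b 0) := ⟨fun _ _ _ => slt_trans⟩
  have : Std.Irrefl (fun a b : Fin n => slt x a 0 b 0) := ⟨fun _ => slt_irrefl _ _⟩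
  exact Finite.wellFounded_of_trans_of_irrefl _

theorem wf_slots (m : ℕ) (x : Fin n → ℝ) :
    WellFounded (fun a b : Fin n × Fin (m + 1) => slt x a.1 a.2 b.1 b.2) := by
  have : IsTrans (Fin n × Fin (m + 1)) (fun a b => slt x a.1 a.2 b.1 b.2) :=
    ⟨fun _ _ _ => slt_trans⟩
  have : Std.Irrefl (fun a b : Fin n × Fin (m + 1) => slt x a.1 a.2 b.1 b.2) :=
    ⟨fun _ => slt_irrefl _ _⟩
  exact Finite.wellFounded_of_trans_of_irrefl _

theorem wf_slots' (m : ℕ) (x : Fin n → ℝ) :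
    WellFounded (fun a b : Fin n × Fin (m + 1) => slt x b.1 b.2 a.1 a.2) := by
  have : IsTrans (Fin n × Fin (m + 1)) (fun a b => slt x b.1 b.2 a.1 a.2) :=
    ⟨fun _ _ _ h1 h2 => slt_trans h2 h1⟩
  have : Std.Irrefl (fun a b : Fin n × Fin (m + 1) => slt x b.1 b.2 a.1 a.2) :=
    ⟨fun _ => slt_irrefl _ _⟩
  exact Finite.wellFounded_of_trans_of_irrefl _

/-- The slot `(j,s)` is the predecessor of `i`. -/
def IsPred (m : ℕ) (x : Fin n → ℝ) (i j : Fin n) (s : ℕ) : Prop :=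
  s ≤ m ∧ slt x j s i 0 ∧ ∀ k t, t ≤ m → slt x k t i 0 → ¬ slt x j s k t

theorem exists_pred (m : ℕ) (x : Fin n → ℝ) (i j : Fin n) (s : ℕ) (hs : s ≤ m)
    (h : slt x j s i 0) : ∃ k t, IsPred m x i k t := by
  obtain ⟨⟨k, t⟩, h1, h2⟩ := (wf_slots' m x).has_min {p | slt x p.1 p.2 i 0}
    ⟨(j, ⟨s, by omega⟩), h⟩
  refine ⟨k, t, by have := t.2; omega, h1, fun k' t' ht' h' => ?_⟩
  exact h2 (k', ⟨t', by omega⟩) h'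

theorem IsPred.unique {i j k : Fin n} {s t : ℕ} (h : IsPred m x i j s) (h' : IsPred m x i k t) :
    j = k ∧ s = t := by
  rcases slt_total (x := x) j k s t with h1 | h1 | h1
  · exact absurd h1 (h.2.2 _ _ h'.1 h'.2.1)
  · exact h1
  · exact absurd h1 (h'.2.2 _ _ h.1 h.2.1)

theorem IsPred.inj {i i' j : Fin n} {s : ℕ} (h : IsPred m x i j s) (h' : IsPred m x i' j s) :
    i = i' := by
  rcases slt_total (x := x) i i' 0 0 with h1 | h1 | h1
  · exact absurd h.2.1 (h'.2.2 _ _ (Nat.zero_le _) h1)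
  · exact h1.1
  · exact absurd h'.2.1 (h.2.2 _ _ (Nat.zero_le _) h1)

theorem exists_tree (m : ℕ) (x : Fin n → ℝ) : ∃ T : Tree m n, Comp T x := by
  have hlt : ∀ i j s, IsPred m x i j s → slt x j 0 i 0 := by
    intro i j s h
    have h1 := h.2.1
    rcases Nat.eq_zero_or_pos s with h0 | h0
    · subst h0; exact h1
    · left
      have := slt_zero_le h1
      have : (0 : ℝ) < s := by exact_mod_cast h0
      simp; linarith
  obtain ⟨path, hpath⟩ : ∃ path : Fin n → List ℕ, ∀ i, path i =
      if h : ∃ p : Fin n × ℕ, IsPred m x i p.1 p.2 then path h.choose.1 ++ [h.choose.2] else [] := by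
    refine ⟨(wf_slt x).fix (fun i rec =>
      if h : ∃ p : Fin n × ℕ, IsPred m x i p.1 p.2 then
        rec h.choose.1 (hlt _ _ _ h.choose_spec) ++ [h.choose.2] else []), fun i => ?_⟩
    rw [WellFounded.fix_eq]
  have hp1 : ∀ i j s, IsPred m x i j s → path i = path j ++ [s] := by
    intro i j s h
    have hex : ∃ p : Fin n × ℕ, IsPred m x i p.1 p.2 := ⟨(j, s), h⟩
    rw [hpath i, dif_pos hex]
    obtain ⟨e1, e2⟩ := h.unique hex.choose_spec
    rw [← e1, ← e2]
  have hp0 : ∀ i, (∀ j s, ¬ IsPred m x i j s) → path i = [] := by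
    intro i h
    rw [hpath i, dif_neg]
    rintro ⟨p, hp⟩
    exact h _ _ hp
  have hp2 : ∀ i, path i ≠ [] → ∃ j s, IsPred m x i j s := by
    intro i h
    by_contra hc
    push Not at hc
    exact h (hp0 i hc)
  have hp3 : ∀ i, path i = [] → ∀ j s, s ≤ m → ¬ slt x j s i 0 := by
    intro i h j s hs hc
    obtain ⟨k, t, hk⟩ := exists_pred m x i j s hs hc
    rw [hp1 i k t hk] at h
    simp at h
  have hinj : ∀ N i i', (path i).length ≤ N → path i = path i' → i = i' := by
    intro N
    induction N with
    | zero =>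
      intro i i' hl he
      have h0 : path i = [] := List.length_eq_zero_iff.mp (by omega)
      have h0' : path i' = [] := he ▸ h0
      rcases slt_total (x := x) i i' 0 0 with h1 | h1 | h1
      · exact absurd h1 (hp3 i' h0' _ _ (Nat.zero_le _))
      · exact h1.1
      · exact absurd h1 (hp3 i h0 _ _ (Nat.zero_le _))
    | succ N ih =>
      intro i i' hl he
      by_cases h0 : path i = []
      · have h0' : path i' = [] := he ▸ h0
        rcases slt_total (x := x) i i' 0 0 with h1 | h1 | h1
        · exact absurd h1 (hp3 i' h0' _ _ (Nat.zero_le _))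
        · exact h1.1
        · exact absurd h1 (hp3 i h0 _ _ (Nat.zero_le _))
      · have h0' : path i' ≠ [] := he ▸ h0
        obtain ⟨j, s, h⟩ := hp2 i h0
        obtain ⟨j', s', h'⟩ := hp2 i' h0'
        have e := he
        rw [hp1 _ _ _ h, hp1 _ _ _ h'] at e
        obtain ⟨e1, e2⟩ := List.append_inj' e (by simp)
        have e3 : s = s' := by simpa using e2
        have e4 : j = j' := ih j j' (by
          have := hp1 _ _ _ h
          rw [this] at hl
          simp at hl; omega) e1
        subst e3; subst e4
        exact h.inj h'
  let T : Tree m n :=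
    { path := path
      entry_le := by
        have : ∀ N v, (path v).length ≤ N → ∀ s ∈ path v, s ≤ m := by
          intro N
          induction N with
          | zero =>
            intro v hv s hs
            have h0 : path v = [] := List.length_eq_zero_iff.mp (by omega)
            rw [h0] at hs; simp at hs
          | succ N ih =>
            intro v hv s hs
            by_cases h0 : path v = []
            · rw [h0] at hs; simp at hs
            · obtain ⟨j, t, h⟩ := hp2 v h0
              have e := hp1 _ _ _ h
              rw [e] at hs hv
              simp at hs hv
              rcases hs with hs | hs
              · exact ih j (by omega) s hs
              · rw [hs]; exact h.1
        exact fun v => this _ v le_rfl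
      inj := fun i i' h => hinj _ i i' le_rfl h
      parent_closed := by
        intro v hv
        obtain ⟨j, t, h⟩ := hp2 v hv
        exact ⟨j, by rw [hp1 _ _ _ h]; simp⟩ }
  have hchild : ∀ i j s, T.IsChild i j s → IsPred m x i j s := by
    intro i j s h
    have h' : path i = path j ++ [s] := h
    obtain ⟨j', s', hp⟩ := hp2 i (by rw [h']; simp)
    obtain ⟨rfl, rfl⟩ := child_unique h (hp1 _ _ _ hp : T.IsChild i j' s')
    exact hp
  exact ⟨T, hp3, fun i j s h => (hchild i j s h).2.1, fun i j s h => (hchild i j s h).2.2⟩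

theorem marks_child {T : Tree m n} {i j : Fin n} {s : ℕ} (h : T.IsChild i j s) :
    i ∈ marks T x ↔ x i = x j + s := by
  constructor
  · rintro ⟨j', s', h1, h2⟩
    obtain ⟨rfl, rfl⟩ := child_unique h h1
    exact h2
  · exact fun h1 => ⟨j, s, h, h1⟩

theorem Comp.isMarking {T : Tree m n} (hT : Comp T x) : IsMarking T (marks T x) := by
  rintro i ⟨j, s, h, he⟩
  have hlt := hT.lt _ _ _ h
  have htie := slt_tie hlt he
  refine ⟨j, s, ⟨h, ?_⟩, fun h0 => ?_⟩
  · rintro t hst htm ⟨k, hk⟩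
    have hk1 := slt_zero_le (hT.lt _ _ _ hk)
    have hc : ((t - s : ℕ) : ℝ) = t - s := by push_cast [hst.le]; ring
    have hpos : (s : ℝ) < t := by exact_mod_cast hst
    refine hT.max k j t hk i (t - s) (by omega) (slt_of_le ?_ (Or.inl (by omega))) ?_
    · rw [hc]; linarith
    · rw [slt_sub_left (by omega)]
      have : t - (t - s) = s := by omega
      rw [this]; exact hlt
  · rcases htie with h1 | h1
    · omega
    · exact h1

theorem rtg_symm {α : Type*} {r : α → α → Prop} (hr : ∀ a b, r a b → r b a) {a b : α}
    (h : Relation.ReflTransGen r a b) : Relation.ReflTransGen r b a := by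
  induction h with
  | refl => exact Relation.ReflTransGen.refl
  | tail _ hstep ih => exact Relation.ReflTransGen.head (hr _ _ hstep) ih

theorem sim_symm {T : Tree m n} {μ : Set (Fin n)} {a b : Fin n} (h : simMu T μ a b) :
    simMu T μ b a := by
  exact rtg_symm (fun _ _ h => h.symm) h

theorem sim_trans {T : Tree m n} {μ : Set (Fin n)} {a b c : Fin n} (h : simMu T μ a b)
    (h' : simMu T μ b c) : simMu T μ a c := Relation.ReflTransGen.trans h h'

theorem child_drift {T : Tree m n} {i j : Fin n} {s : ℕ} (h : T.IsChild i j s) :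
    T.drift i = T.drift j + s := by
  unfold Tree.drift; rw [h]; simp

theorem sim_drift {T : Tree m n} {a b : Fin n} (h : simMu T (marks T x) a b) :
    x a - x b = (T.drift a : ℝ) - T.drift b := by
  induction h with
  | refl => simp
  | tail _ hstep ih =>
    rcases hstep with ⟨h1, s, h2⟩ | ⟨h1, s, h2⟩
    · have h3 := (marks_child h2).mp h1
      have h4 := child_drift h2
      rw [h4] at ih; push_cast at ih
      linarith
    · have h3 := (marks_child h2).mp h1
      have h4 := child_drift h2
      rw [h4]; push_cast
      linarith

theorem Comp.sim_of_tie {T : Tree m n} (hT : Comp T x) :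
    ∀ (N : ℕ) (a b : Fin n) (r : ℕ), (T.path a).length ≤ N → r ≤ m → slt x b r a 0 →
      x a = x b + r → simMu T (marks T x) a b := by
  intro N
  induction N with
  | zero =>
    intro a b r hl hr h he
    have h0 : T.path a = [] := List.length_eq_zero_iff.mp (by omega)
    exact absurd h (hT.root a h0 b r hr)
  | succ N ih =>
    intro a b r hl hr h he
    by_cases h0 : T.path a = []
    · exact absurd h (hT.root a h0 b r hr)
    obtain ⟨p, q, hpq⟩ := exists_parent T a h0
    have hlen := child_len hpq
    have h1 := slt_zero_le (hT.lt _ _ _ hpq)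
    have h2 : x b + r ≤ x p + q := by
      rcases (hT.lt_child_iff hpq hr).mp h with ⟨rfl, rfl⟩ | h2
      · exact le_rfl
      · exact slt_le h2
    have hap : x a = x p + q := by linarith
    have hmark : a ∈ marks T x := ⟨p, q, hpq, hap⟩
    have hsim : simMu T (marks T x) a p := Relation.ReflTransGen.single (Or.inl ⟨hmark, q, hpq⟩)
    rcases (hT.lt_child_iff hpq hr).mp h with ⟨rfl, rfl⟩ | h3
    · exact hsim
    · have hxle : x b ≤ x p := by
        rcases h3 with h3 | ⟨_, h3 | h3⟩
        · linarith
        · exact h3.le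
        · exact h3.1.le
      have hqr : q ≤ r := by
        have : (q : ℝ) ≤ r := by linarith
        exact_mod_cast this
      have hc : ((r - q : ℕ) : ℝ) = r - q := by push_cast [hqr]; ring
      refine sim_trans hsim (ih p b (r - q) (by omega) (by omega) ?_ ?_)
      · rw [← slt_sub_left hqr]; exact h3
      · rw [hc]; linarith

theorem Comp.sim_of_int {T : Tree m n} (hT : Comp T x) {a b : Fin n} {k : ℤ}
    (hk : |k| ≤ m) (h : x a - x b = k) : simMu T (marks T x) a b := by
  rw [abs_le] at hk
  have main : ∀ a b : Fin n, ∀ r : ℕ, r ≤ m → x a = x b + r → simMu T (marks T x) a b := by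
    intro a b r hr he
    by_cases hs : slt x b r a 0
    · exact hT.sim_of_tie _ a b r le_rfl hr hs he
    · have h0 : r = 0 := by
        by_contra h0
        exact hs (slt_of_le he.symm.le (Or.inl (by omega)))
      subst h0
      rcases slt_total (x := x) b a 0 0 with h1 | h1 | h1
      · exact absurd h1 hs
      · rw [h1.1]; exact Relation.ReflTransGen.refl
      · exact sim_symm (hT.sim_of_tie _ b a 0 le_rfl hr h1 (by simp at he ⊢; exact he.symm))
  rcases le_total 0 k with h0 | h0
  · obtain ⟨r, rfl⟩ := Int.eq_ofNat_of_zero_le h0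
    exact main a b r (by omega) (by push_cast at h; linarith)
  · obtain ⟨r, hr⟩ := Int.eq_ofNat_of_zero_le (show 0 ≤ -k by omega)
    refine sim_symm (main b a r (by omega) ?_)
    have : (k : ℝ) = -(r : ℝ) := by
      have : k = -(r : ℤ) := by omega
      rw [this]; push_cast; rfl
    rw [this] at h; linarith

end slots

/-! ### Realising a marked tree by a point -/

/-- Encoding of paths for which the lexicographic order is the right-to-left preorder. -/
def pkey (p : List ℕ) : List ℤ := p.map (fun s : ℕ => -(s : ℤ))

theorem pkey_inj {p q : List ℕ} (h : pkey p = pkey q) : p = q := by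
  unfold pkey at h
  refine List.map_injective_iff.mpr ?_ h
  intro a b hab
  simpa using hab

theorem pkey_between : ∀ (j k : List ℕ) (s : ℕ), pkey j < pkey k → pkey k < pkey (j ++ [s]) →
    ∃ u v, k = j ++ u :: v ∧ s < u := by
  intro j
  induction j with
  | nil =>
    intro k s h1 h2
    cases k with
    | nil => exact absurd h1 (lt_irrefl _)
    | cons u v =>
      refine ⟨u, v, rfl, ?_⟩
      simp only [pkey, List.map_cons, List.nil_append, List.map_nil, List.cons_lt_cons_iff] at h2
      rcases h2 with h2 | ⟨_, h2⟩
      · omega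
      · exact absurd h2 (List.not_lt_nil _)
  | cons c j ih =>
    intro k s h1 h2
    cases k with
    | nil => exact absurd h1 (List.not_lt_nil _)
    | cons d k =>
      simp only [pkey, List.map_cons, List.cons_append, List.cons_lt_cons_iff] at h1 h2
      have hcd : c = d := by omega
      subst hcd
      have h1' : pkey j < pkey k := by simpa [pkey] using h1
      have h2' : pkey k < pkey (j ++ [s]) := by simpa [pkey] using h2
      obtain ⟨u, v, rfl, hu⟩ := ih k s h1' h2'
      exact ⟨u, v, rfl, hu⟩

theorem pkey_append_lt : ∀ (j : List ℕ) (s : ℕ), pkey j < pkey (j ++ [s]) := by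
  intro j
  induction j with
  | nil => intro s; exact List.nil_lt_cons _ _
  | cons c j ih =>
    intro s
    simp only [pkey, List.map_cons, List.cons_append, List.cons_lt_cons_iff]
    right
    exact ⟨trivial, ih s⟩

theorem frac_le {n A B e e' : ℕ} (_he : e ≤ n) (he' : e' ≤ n)
    (h : (A : ℝ) + e / (n + 1) ≤ B + e' / (n + 1)) : A < B ∨ (A = B ∧ e ≤ e') := by
  have hn : (0 : ℝ) < n + 1 := by positivity
  have h1 : (A : ℝ) * (n + 1) + e ≤ B * (n + 1) + e' := by
    have := mul_le_mul_of_nonneg_right h hn.le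
    field_simp at this
    linarith
  have h2 : A * (n + 1) + e ≤ B * (n + 1) + e' := by exact_mod_cast h1
  rcases lt_trichotomy A B with h3 | h3 | h3
  · exact Or.inl h3
  · subst h3; right; exact ⟨rfl, by omega⟩
  · exfalso
    have : (B + 1) * (n + 1) ≤ A * (n + 1) := Nat.mul_le_mul_right _ h3
    rw [Nat.add_mul] at this
    omega

section realise
variable {m n : ℕ}

theorem prefix_closed (T : Tree m n) : ∀ (N : ℕ) (w q : List ℕ) (i : Fin n), w.length ≤ N →
    T.path i = q ++ w → ∃ j, T.path j = q := by
  intro N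
  induction N with
  | zero =>
    intro w q i hw h
    have : w = [] := List.length_eq_zero_iff.mp (by omega)
    subst this
    exact ⟨i, by simpa using h⟩
  | succ N ih =>
    intro w q i hw h
    by_cases h0 : w = []
    · subst h0
      exact ⟨i, by simpa using h⟩
    · obtain ⟨p, hp⟩ := T.parent_closed i (by rw [h]; simp [h0])
      rw [h, List.dropLast_append_of_ne_nil h0] at hp
      exact ih w.dropLast q p (by simp; omega) hp

/-- No node lies strictly between a node and its cadet. -/
theorem cadet_between {T : Tree m n} {i j k : Fin n} {s : ℕ} (h : T.IsCadet i j s)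
    (h1 : pkey (T.path j) < pkey (T.path k)) (h2 : pkey (T.path k) < pkey (T.path i)) : False := by
  rw [h.1] at h2
  obtain ⟨u, v, he, hu⟩ := pkey_between _ _ _ h1 h2
  have hum : u ≤ m := T.entry_le k u (by rw [he]; simp)
  obtain ⟨l, hl⟩ := prefix_closed T v.length v (T.path j ++ [u]) k le_rfl (by rw [he]; simp)
  exact h.2 u hu hum ⟨l, hl⟩

/-- The number of unmarked nodes weakly before `i`. -/
noncomputable def urank (T : Tree m n) (μ : Set (Fin n)) (i : Fin n) : ℕ :=
  (Finset.univ.filter (fun k => k ∉ μ ∧ pkey (T.path k) ≤ pkey (T.path i))).card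

theorem urank_le (T : Tree m n) (μ : Set (Fin n)) (i : Fin n) : urank T μ i ≤ n := by
  unfold urank
  refine (Finset.card_le_univ _).trans ?_
  simp

theorem urank_mono {T : Tree m n} {μ : Set (Fin n)} {i j : Fin n}
    (h : pkey (T.path i) ≤ pkey (T.path j)) : urank T μ i ≤ urank T μ j := by
  unfold urank
  apply Finset.card_le_card
  intro k
  simp only [Finset.mem_filter, Finset.mem_univ, true_and]
  exact fun hk => ⟨hk.1, hk.2.trans h⟩

theorem urank_lt {T : Tree m n} {μ : Set (Fin n)} {i j : Fin n}
    (h : pkey (T.path i) < pkey (T.path j)) (hj : j ∉ μ) : urank T μ i < urank T μ j := by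
  unfold urank
  apply Finset.card_lt_card
  rw [Finset.ssubset_iff_of_subset]
  · refine ⟨j, ?_, ?_⟩
    · simp [hj]
    · simp [h]
  · intro k
    simp only [Finset.mem_filter, Finset.mem_univ, true_and]
    exact fun hk => ⟨hk.1, hk.2.trans h.le⟩

theorem urank_eq {T : Tree m n} {μ : Set (Fin n)} (hμ : IsMarking T μ) {i j : Fin n} {s : ℕ}
    (h : T.IsChild i j s) (hi : i ∈ μ) : urank T μ i = urank T μ j := by
  refine le_antisymm ?_ (urank_mono (by rw [h]; exact (pkey_append_lt _ _).le))
  obtain ⟨j', s', hc, -⟩ := hμ i hi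
  obtain ⟨rfl, rfl⟩ := child_unique h hc.1
  unfold urank
  apply Finset.card_le_card
  intro k
  simp only [Finset.mem_filter, Finset.mem_univ, true_and]
  rintro ⟨hk1, hk2⟩
  refine ⟨hk1, ?_⟩
  by_contra hlt
  push Not at hlt
  rcases hk2.lt_or_eq with h3 | h3
  · exact cadet_between hc hlt h3
  · have : k = i := T.inj (pkey_inj h3)
    exact hk1 (this ▸ hi)

theorem urank_chain {T : Tree m n} {μ : Set (Fin n)} (hμ : IsMarking T μ) :
    ∀ (N : ℕ) (i j : Fin n), (T.path j).length ≤ N → pkey (T.path i) < pkey (T.path j) →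
      urank T μ i = urank T μ j → T.drift i ≤ T.drift j ∧ (T.drift i = T.drift j → i < j) := by
  intro N
  induction N with
  | zero =>
    intro i j hl h
    have : T.path j = [] := List.length_eq_zero_iff.mp (by omega)
    rw [this] at h
    exact absurd h (List.not_lt_nil _)
  | succ N ih =>
    intro i j hl h he
    have hj : j ∈ μ := by
      by_contra hj
      have := urank_lt h hj
      omega
    obtain ⟨p, s, hc, hs⟩ := hμ j hj
    have hlen := child_len hc.1
    have hd := child_drift hc.1
    have hpj : pkey (T.path p) < pkey (T.path j) := by rw [hc.1]; exact pkey_append_lt _ _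
    rcases lt_trichotomy (pkey (T.path i)) (pkey (T.path p)) with h1 | h1 | h1
    · have e1 := urank_mono (μ := μ) h1.le
      have e2 := urank_mono (μ := μ) hpj.le
      obtain ⟨h2, h3⟩ := ih i p (by omega) h1 (by omega)
      refine ⟨by omega, fun h4 => ?_⟩
      exact lt_trans (h3 (by omega)) (hs (by omega))
    · have : i = p := T.inj (pkey_inj h1)
      subst this
      exact ⟨by omega, fun h4 => hs (by omega)⟩
    · exact (cadet_between hc h1 h).elim

theorem realise {T : Tree m n} {μ : Set (Fin n)} (hμ : IsMarking T μ) :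
    ∃ x : Fin n → ℝ, Comp T x ∧ marks T x = μ := by
  let e := urank T μ
  have hen : ∀ i, e i ≤ n := urank_le T μ
  let x : Fin n → ℝ := fun i => (T.drift i : ℝ) + (e i : ℝ) / (n + 1)
  have hx : ∀ i, x i = (T.drift i : ℝ) + (e i : ℝ) / (n + 1) := fun i => rfl
  have hn : (0 : ℝ) < n + 1 := by positivity
  -- comparing slots
  have hle : ∀ a r b s, x a + (r : ℕ) ≤ x b + (s : ℕ) →
      T.drift a + r < T.drift b + s ∨ (T.drift a + r = T.drift b + s ∧ e a ≤ e b) := by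
    intro a r b s h
    apply frac_le (hen a) (hen b)
    rw [hx, hx] at h
    push_cast
    linarith
  have hchain : ∀ i j, pkey (T.path i) < pkey (T.path j) → e i = e j →
      T.drift i ≤ T.drift j ∧ (T.drift i = T.drift j → i < j) :=
    fun i j h1 h2 => urank_chain hμ _ i j le_rfl h1 h2
  -- slots in the same block
  have hslot : ∀ a r b s, pkey (T.path a) < pkey (T.path b) → e a = e b →
      T.drift a + r = T.drift b + s → slt x a r b s := by
    intro a r b s h1 h2 h3
    obtain ⟨h4, h5⟩ := hchain a b h1 h2
    right
    constructor
    · rw [hx, hx, h2]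
      have : ((T.drift a + r : ℕ) : ℝ) = (T.drift b + s : ℕ) := by rw [h3]
      push_cast at this
      linarith
    · rcases h4.lt_or_eq with h6 | h6
      · left; rw [hx, hx, h2]
        have : (T.drift a : ℝ) < T.drift b := by exact_mod_cast h6
        linarith
      · right
        exact ⟨by rw [hx, hx, h2, h6], h5 h6⟩
  have hchildlt : ∀ i j s, T.IsChild i j s → pkey (T.path j) < pkey (T.path i) := by
    intro i j s h; rw [h]; exact pkey_append_lt _ _
  have hlt : ∀ i j s, T.IsChild i j s → slt x j s i 0 := by
    intro i j s h
    have hd := child_drift h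
    have hmono : e j ≤ e i := urank_mono (hchildlt _ _ _ h).le
    rcases hmono.lt_or_eq with h1 | h1
    · left
      rw [hx, hx, hd]
      have h2 : (e j : ℝ) < e i := by exact_mod_cast h1
      have h3 : (e j : ℝ) / (n + 1) < e i / (n + 1) := by gcongr
      push_cast
      linarith
    · exact hslot _ _ _ _ (hchildlt _ _ _ h) h1 (by omega)
  refine ⟨x, ⟨?_, hlt, ?_⟩, ?_⟩
  · intro i hi j s hs hc
    have h1 := hle j s i 0 (slt_le hc)
    have hdi : T.drift i = 0 := by unfold Tree.drift; rw [hi]; rfl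
    rw [hdi] at h1
    have h2 : T.drift j = 0 ∧ s = 0 ∧ e j ≤ e i := by omega
    by_cases hij : i = j
    · subst hij
      rw [h2.2.1] at hc
      exact slt_irrefl _ _ hc
    have h3 : pkey (T.path i) < pkey (T.path j) := by
      rw [hi]
      cases hj : T.path j with
      | nil => exact absurd (T.inj (hi.trans hj.symm)) hij
      | cons u v => exact List.nil_lt_cons _ _
    have h4 : e i ≤ e j := urank_mono h3.le
    exact slt_asymm hc (hslot i 0 j s h3 (by omega) (by omega))
  · intro i j s h k t ht h1 h2
    have hd := child_drift h
    have a1 := hle k t i 0 (slt_le h1)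
    have a2 := hle j s k t (slt_le h2)
    have hdk : T.drift k + t = T.drift i := by omega
    have e1 : e k ≤ e i := by omega
    have e2 : e j ≤ e k := by omega
    rcases lt_trichotomy (pkey (T.path k)) (pkey (T.path j)) with h3 | h3 | h3
    · have : e k ≤ e j := urank_mono h3.le
      exact slt_asymm h2 (hslot k t j s h3 (by omega) (by omega))
    · have : k = j := T.inj (pkey_inj h3)
      subst this
      have : s = t := by omega
      subst this
      exact slt_irrefl _ _ h2
    · rcases lt_trichotomy (pkey (T.path k)) (pkey (T.path i)) with h4 | h4 | h4
      · rw [h] at h4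
        obtain ⟨u, v, he, hu⟩ := pkey_between _ _ _ h3 h4
        have : T.drift k = T.drift j + (u + v.sum) := by
          unfold Tree.drift; rw [he]; simp
        omega
      · have : k = i := T.inj (pkey_inj h4)
        subst this
        have : t = 0 := by omega
        subst this
        exact slt_irrefl _ _ h1
      · have : e i ≤ e k := urank_mono h4.le
        exact slt_asymm h1 (hslot i 0 k t h4 (by omega) (by omega))
  · ext i
    constructor
    · rintro ⟨j, s, h, he⟩
      by_contra hi
      have h1 : e j < e i := urank_lt (hchildlt _ _ _ h) hi
      rw [hx, hx, child_drift h] at he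
      have h2 : (e j : ℝ) < e i := by exact_mod_cast h1
      have h3 : (e j : ℝ) / (n + 1) < e i / (n + 1) := by gcongr
      push_cast at he
      linarith
    · intro hi
      obtain ⟨j, s, hc, -⟩ := hμ i hi
      refine ⟨j, s, hc.1, ?_⟩
      have h1 : e i = e j := urank_eq hμ hc.1 hi
      rw [hx, hx, child_drift hc.1, h1]
      push_cast
      ring

end realise

/-! ### Blocks of a face, virtual adjacency and uniqueness -/

section faces
variable {m n : ℕ} {S : Set ℤ} {x y z : Fin n → ℝ}

/-- Connectivity in the graph of equalities `x a - x b ∈ S`. -/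
def Conn (S : Set ℤ) (x : Fin n → ℝ) : Fin n → Fin n → Prop :=
  Relation.ReflTransGen (fun a b => ∃ s ∈ S, x a - x b = (s : ℝ))

/-- `x` and `y` are on the same side of all the hyperplanes. -/
def FEq (S : Set ℤ) (x y : Fin n → ℝ) : Prop :=
  ∀ a b : Fin n, ∀ s ∈ S, (x a - x b = (s : ℝ) ↔ y a - y b = (s : ℝ)) ∧
    (x a - x b < (s : ℝ) ↔ y a - y b < (s : ℝ))

theorem FEq.symm (h : FEq S x y) : FEq S y x :=
  fun a b s hs => ⟨(h a b s hs).1.symm, (h a b s hs).2.symm⟩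

theorem FEq.refl (S : Set ℤ) (x : Fin n → ℝ) : FEq S x x :=
  fun _ _ _ _ => ⟨Iff.rfl, Iff.rfl⟩

theorem FEq.trans (h : FEq S x y) (h' : FEq S y z) : FEq S x z :=
  fun a b s hs => ⟨(h a b s hs).1.trans (h' a b s hs).1, (h a b s hs).2.trans (h' a b s hs).2⟩

theorem Conn.congr (h : FEq S x y) {a b : Fin n} (hc : Conn S x a b) :
    Conn S y a b ∧ y a - y b = x a - x b := by
  induction hc with
  | refl => exact ⟨Relation.ReflTransGen.refl, by simp⟩
  | tail _ hstep ih =>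
    obtain ⟨s, hs, he⟩ := hstep
    have he' := (h _ _ s hs).1.mp he
    exact ⟨ih.1.tail ⟨s, hs, he'⟩, by linarith [ih.2]⟩

theorem Conn.int {a b : Fin n} (hc : Conn S x a b) : ∃ k : ℤ, x a - x b = k := by
  induction hc with
  | refl => exact ⟨0, by simp⟩
  | tail _ hstep ih =>
    obtain ⟨s, hs, he⟩ := hstep
    obtain ⟨k, hk⟩ := ih
    exact ⟨k + s, by push_cast; linarith⟩

theorem Conn.symm (hsym : ∀ s : ℤ, s ∈ S ↔ -s ∈ S) {a b : Fin n} (hc : Conn S x a b) :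
    Conn S x b a := by
  refine rtg_symm ?_ hc
  rintro a b ⟨s, hs, he⟩
  exact ⟨-s, (hsym s).mp hs, by push_cast; linarith⟩

/-- The blocks of `i` and `j` are adjacent when placed with `i` at height `s` above `j`. -/
def Ad (S : Set ℤ) (x : Fin n → ℝ) (i j : Fin n) (s : ℕ) : Prop :=
  ∃ i' j', Conn S x i i' ∧ Conn S x j j' ∧ ∃ r ∈ S, (x i' - x i) + s + (x j - x j') = ((r : ℤ) : ℝ)

theorem Ad.congr (h : FEq S x y) {i j : Fin n} {s : ℕ} (ha : Ad S x i j s) : Ad S y i j s := by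
  obtain ⟨i', j', h1, h2, r, hr, he⟩ := ha
  refine ⟨i', j', (h1.congr h).1, (h2.congr h).1, r, hr, ?_⟩
  linarith [(h1.congr h).2, (h2.congr h).2]

theorem Ad.sign (h : FEq S x y) {i j : Fin n} {s : ℕ} (ha : Ad S x i j s) :
    (x i = x j + s ↔ y i = y j + s) ∧ (x i < x j + s ↔ y i < y j + s) := by
  obtain ⟨i', j', h1, h2, r, hr, he⟩ := ha
  have e1 := (h1.congr h).2
  have e2 := (h2.congr h).2
  have key := h i' j' r hr
  constructor
  · constructor
    · intro h3
      have := key.1.mp (by linarith)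
      linarith
    · intro h3
      have := key.1.mpr (by linarith)
      linarith
  · constructor
    · intro h3
      have := key.2.mp (by linarith)
      linarith
    · intro h3
      have := key.2.mpr (by linarith)
      linarith

theorem Ad.symm_zero (hsym : ∀ s : ℤ, s ∈ S ↔ -s ∈ S) {i j : Fin n} (ha : Ad S x i j 0) :
    Ad S x j i 0 := by
  obtain ⟨i', j', h1, h2, r, hr, he⟩ := ha
  refine ⟨j', i', h2, h1, -r, (hsym r).mp hr, ?_⟩
  push_cast at he ⊢
  linarith

theorem jump_up (hsym : ∀ s : ℤ, s ∈ S ↔ -s ∈ S)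
    (hclosed : ∀ s t : ℕ, (s : ℤ) ∉ S → (t : ℤ) ∉ S → ((s : ℤ) + (t : ℤ)) ∉ S)
    {a i p : Fin n} {s : ℕ} (hA : ¬ Ad S x a i s) (hc : Conn S x a p) :
    ∃ k : ℕ, (x p - x a) + s = k ∧ (k : ℤ) ∉ S := by
  have hnot : ∀ p, Conn S x a p → ∀ k : ℤ, (x p - x a) + s = k → k ∉ S := by
    intro p hp k hk hS
    exact hA ⟨p, i, hp, Relation.ReflTransGen.refl, k, hS, by simpa using hk⟩
  induction hc with
  | refl => exact ⟨s, by simp, hnot a Relation.ReflTransGen.refl s (by simp)⟩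
  | @tail p p' hcp hstep ih =>
    obtain ⟨r, hr, he⟩ := hstep
    obtain ⟨k, hk, hkS⟩ := ih
    have hcp' : Conn S x a p' := Relation.ReflTransGen.tail hcp ⟨r, hr, he⟩
    have hval : (x p' - x a) + s = ((k - r : ℤ) : ℝ) := by push_cast; linarith
    have hn := hnot p' hcp' _ hval
    rcases le_or_gt 0 ((k : ℤ) - r) with h0 | h0
    · obtain ⟨l, hl⟩ := Int.eq_ofNat_of_zero_le h0
      refine ⟨l, ?_, ?_⟩
      · rw [hval, hl]; simp
      · rw [← Int.ofNat_eq_natCast, ← Int.ofNat_eq_natCast] at *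
        rw [hl] at hn; exact hn
    · exfalso
      obtain ⟨l, hl⟩ := Int.eq_ofNat_of_zero_le (show 0 ≤ r - (k : ℤ) by omega)
      have hlS : (l : ℤ) ∉ S := by
        rw [hsym]
        have : -(l : ℤ) = k - r := by omega
        rw [this]; exact hn
      have := hclosed k l hkS hlS
      apply this
      have : (k : ℤ) + l = r := by omega
      rw [this]; exact hr

theorem jump_down (hsym : ∀ s : ℤ, s ∈ S ↔ -s ∈ S)
    (hclosed : ∀ s t : ℕ, (s : ℤ) ∉ S → (t : ℤ) ∉ S → ((s : ℤ) + (t : ℤ)) ∉ S)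
    {c i q : Fin n} {t : ℕ} (hA : ¬ Ad S x i c t) (hc : Conn S x c q) :
    ∃ k : ℕ, t + (x c - x q) = k ∧ (k : ℤ) ∉ S := by
  have hnot : ∀ q, Conn S x c q → ∀ k : ℤ, t + (x c - x q) = k → k ∉ S := by
    intro q hq k hk hS
    exact hA ⟨i, q, Relation.ReflTransGen.refl, hq, k, hS, by simpa using hk⟩
  induction hc with
  | refl => exact ⟨t, by simp, hnot c Relation.ReflTransGen.refl t (by simp)⟩
  | @tail q q' hcq hstep ih =>
    obtain ⟨r, hr, he⟩ := hstep
    obtain ⟨k, hk, hkS⟩ := ih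
    have hcq' : Conn S x c q' := Relation.ReflTransGen.tail hcq ⟨r, hr, he⟩
    have hval : t + (x c - x q') = ((k + r : ℤ) : ℝ) := by push_cast; linarith
    have hn := hnot q' hcq' _ hval
    rcases le_or_gt 0 ((k : ℤ) + r) with h0 | h0
    · obtain ⟨l, hl⟩ := Int.eq_ofNat_of_zero_le h0
      refine ⟨l, ?_, ?_⟩
      · rw [hval, hl]; simp
      · rw [hl] at hn; exact hn
    · exfalso
      obtain ⟨l, hl⟩ := Int.eq_ofNat_of_zero_le (show 0 ≤ -r - (k : ℤ) by omega)
      have hlS : (l : ℤ) ∉ S := by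
        rw [hsym]
        have : -(l : ℤ) = k + r := by omega
        rw [this]; exact hn
      have := hclosed k l hkS hlS
      apply this
      have : (k : ℤ) + l = -r := by omega
      rw [this]; exact (hsym r).mp hr

theorem jump (hsym : ∀ s : ℤ, s ∈ S ↔ -s ∈ S)
    (hclosed : ∀ s t : ℕ, (s : ℤ) ∉ S → (t : ℤ) ∉ S → ((s : ℤ) + (t : ℤ)) ∉ S)
    {a c : Fin n} (i : Fin n) {s t : ℕ} (hac : a ≠ c)
    (h : Ad S x a c (s + t) ∨ (Conn S x a c ∧ x a = x c + (s + t : ℕ))) :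
    Ad S x a i s ∨ Ad S x i c t := by
  by_contra hcon
  push Not at hcon
  obtain ⟨h1, h2⟩ := hcon
  rcases h with ⟨p, q, hp, hq, r, hr, he⟩ | ⟨hc, he⟩
  · obtain ⟨k, hk, hkS⟩ := jump_up hsym hclosed h1 hp
    obtain ⟨l, hl, hlS⟩ := jump_down hsym hclosed h2 hq
    apply hclosed k l hkS hlS
    have : (r : ℝ) = ((k + l : ℤ) : ℝ) := by push_cast at he ⊢; linarith
    have : r = k + l := by exact_mod_cast this
    rw [← this]; exact hr
  · obtain ⟨k, hk, hkS⟩ := jump_up hsym hclosed h1 hc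
    obtain ⟨l, hl, hlS⟩ := jump_down hsym hclosed h2 (hc.symm hsym)
    have e1 : (k : ℝ) + t = 0 := by push_cast at he; linarith
    have e2 : (l : ℝ) + s = 0 := by push_cast at he; linarith
    have e1' : k + t = 0 := by exact_mod_cast e1
    have e2' : l + s = 0 := by exact_mod_cast e2
    have hs0 : s = 0 := by omega
    rcases Relation.ReflTransGen.cases_head hc with h3 | ⟨b, ⟨r, hr, her⟩, _⟩
    · exact hac h3
    · refine h1 ⟨b, i, Relation.ReflTransGen.single ⟨r, hr, her⟩, Relation.ReflTransGen.refl,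
        -r, (hsym r).mp hr, ?_⟩
      rw [hs0]; push_cast; linarith

theorem Conn.slt_congr (h : FEq S x y) {a b : Fin n} (hc : Conn S x a b) {r s : ℕ}
    (hl : slt x a r b s) : slt y a r b s := by
  have e := (hc.congr h).2
  rcases hl with h1 | ⟨h1, h2 | h2⟩
  · left; linarith
  · right; exact ⟨by linarith, Or.inl (by linarith)⟩
  · right; exact ⟨by linarith, Or.inr ⟨by linarith [h2.1], h2.2⟩⟩

/-- A point which is generic in its face. -/
def Gen (m : ℕ) (S : Set ℤ) (x : Fin n → ℝ) : Prop :=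
  ∀ a b : Fin n, ∀ k : ℤ, |k| ≤ m → x a - x b = k → Conn S x a b

/-- The cadet condition at a point. -/
def CadX (S : Set ℤ) (T : Tree m n) (x : Fin n → ℝ) : Prop :=
  ∀ i j s, T.IsCadet i j s → x i ≠ x j + s → (s = 0 ∧ i < j) ∨ Ad S x i j s

theorem Gen.conn (hg : Gen m S x) {a b : Fin n} {r : ℕ} (hr : r ≤ m) (h : x a = x b + r) :
    Conn S x a b :=
  hg a b r (by simpa using hr) (by push_cast; linarith)

theorem exists_cadet {T : Tree m n} {i j : Fin n} {s : ℕ} (h : T.IsChild i j s) :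
    ∃ i1 t1, s ≤ t1 ∧ T.IsCadet i1 j t1 := by
  have hP : T.SlotNode j s := ⟨i, h⟩
  have h1 := Nat.findGreatest_spec (P := fun t => T.SlotNode j t) (child_le h) hP
  obtain ⟨i1, hi1⟩ := h1
  refine ⟨i1, _, Nat.le_findGreatest (child_le h) hP, hi1, ?_⟩
  intro t ht htm
  exact Nat.findGreatest_is_greatest ht htm

theorem child_ne {T : Tree m n} {i j : Fin n} {s : ℕ} (h : T.IsChild i j s) : i ≠ j := by
  rintro rfl
  have := child_len h
  omega

theorem core (hsym : ∀ s : ℤ, s ∈ S ↔ -s ∈ S)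
    (hclosed : ∀ s t : ℕ, (s : ℤ) ∉ S → (t : ℤ) ∉ S → ((s : ℤ) + (t : ℤ)) ∉ S)
    (hF : FEq S y x) (hg : Gen m S y) {T : Tree m n} (hT : Comp T y) (hcad : CadX S T y)
    (D : Fin n → ℕ → Prop)
    (hDy : ∀ a r b q, r ≤ m → q ≤ m → D b q → slt y a r b q → D a r)
    {i : Fin n} (hi : ∀ k t, t ≤ m → slt x k t i 0 → D k t)
    {u : Fin n} {q : ℕ} (hq : q ≤ m) (hu : ¬ D u q)
    (hw : ∀ a r, r ≤ m → ¬ D a r → ¬ slt y a r u q) :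
    ∀ (N : ℕ) (k : Fin n), (T.path k).length ≤ N → ¬ D k 0 →
      (k = i ∨ (i < k ∧ ¬ Ad S y i k 0 ∧ slt y k 0 i 0)) → q = 0 ∧ (u = i ∨ i < u) := by
  intro N
  induction N with
  | zero =>
    intro k hl hDk hk
    have h0 : T.path k = [] := List.length_eq_zero_iff.mp (by omega)
    rcases slt_total (x := y) k u 0 q with h1 | h1 | h1
    · exact absurd h1 (hw k 0 (Nat.zero_le _) hDk)
    · refine ⟨h1.2.symm, ?_⟩
      rw [← h1.1]
      rcases hk with hk | hk
      · exact Or.inl hk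
      · exact Or.inr hk.1
    · exact absurd h1 (hT.root k h0 u q hq)
  | succ N ih =>
    intro k hl hDk hk
    rcases slt_total (x := y) k u 0 q with h1 | h1 | h1
    · exact absurd h1 (hw k 0 (Nat.zero_le _) hDk)
    · refine ⟨h1.2.symm, ?_⟩
      rw [← h1.1]
      rcases hk with hk | hk
      · exact Or.inl hk
      · exact Or.inr hk.1
    · by_cases h0 : T.path k = []
      · exact absurd h1 (hT.root k h0 u q hq)
      obtain ⟨k2, t2, hpar⟩ := exists_parent T k h0
      have ht2 := child_le hpar
      have hlen := child_len hpar
      have hDk2 : ¬ D k2 t2 := by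
        rcases (hT.lt_child_iff hpar hq).mp h1 with ⟨rfl, rfl⟩ | h2
        · exact hu
        · exact fun hD => hu (hDy _ _ _ _ hq ht2 hD h2)
      have hk2k := hT.lt _ _ _ hpar
      have hk2i : slt y k2 t2 i 0 := by
        rcases hk with rfl | hk
        · exact hk2k
        · exact slt_trans hk2k hk.2.2
      have hnx : ¬ slt x k2 t2 i 0 := fun h => hDk2 (hi _ _ ht2 h)
      have hC : ¬ Conn S y i k2 := fun hc => hnx ((hc.symm hsym).slt_congr hF hk2i)
      have hyne : y i ≠ y k2 + t2 := fun he => hC (hg.conn ht2 he)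
      have hylt : y k2 + t2 < y i := lt_of_le_of_ne (slt_zero_le hk2i) (Ne.symm hyne)
      have hxle : x i ≤ x k2 + t2 := by
        by_contra hc
        push Not at hc
        exact hnx (Or.inl (by simpa using hc))
      have hA : ¬ Ad S y i k2 t2 := by
        intro hA
        have := hA.sign hF
        rcases hxle.lt_or_eq with h2 | h2
        · have := this.2.mpr h2
          linarith
        · exact hyne (this.1.mpr h2)
      obtain ⟨i1, t1, ht1, hcadet⟩ := exists_cadet hpar
      have hAd' : (t1 = 0 ∧ i1 < k2) ∨
          (Ad S y i1 k2 t1 ∨ (Conn S y i1 k2 ∧ y i1 = y k2 + t1)) := by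
        by_cases he : y i1 = y k2 + t1
        · exact Or.inr (Or.inr ⟨hg.conn (child_le hcadet.1) he, he⟩)
        · rcases hcad _ _ _ hcadet he with h2 | h2
          · exact Or.inl h2
          · exact Or.inr (Or.inl h2)
      rcases ht1.lt_or_eq with hlt | heq
      · exfalso
        have hAd2 : Ad S y i1 k2 t1 ∨ (Conn S y i1 k2 ∧ y i1 = y k2 + t1) := by
          rcases hAd' with h2 | h2
          · omega
          · exact h2
        have hsum : (t1 - t2) + t2 = t1 := by omega
        have hcast : ((t1 - t2 : ℕ) : ℝ) = t1 - t2 := by push_cast [ht1]; ring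
        have hj := jump hsym hclosed (x := y) i (s := t1 - t2) (t := t2) (child_ne hcadet.1)
          (by rw [hsum]; exact hAd2)
        have hAi : Ad S y i1 i (t1 - t2) := by
          rcases hj with hj | hj
          · exact hj
          · exact absurd hj hA
        have ho : slt y k2 t1 i (t1 - t2) := by
          rw [slt_sub_left (by omega)]
          have : t1 - (t1 - t2) = t2 := by omega
          rw [this]; exact hk2i
        have hno : ¬ slt y i (t1 - t2) i1 0 := fun hc =>
          hT.max _ _ _ hcadet.1 i (t1 - t2) (by have := child_le hcadet.1; omega) hc ho
        have hy1 : y i1 < y i + (t1 - t2 : ℕ) := by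
          by_contra hc
          push Not at hc
          exact hno (slt_of_le hc (Or.inl (by omega)))
        have hx1 := (hAi.sign hF).2.mp hy1
        have hy2 := slt_zero_le (hT.lt _ _ _ hcadet.1)
        have hx2 : x k2 + t1 ≤ x i1 := by
          rcases hAd2 with h2 | ⟨h2, h3⟩
          · by_contra hc
            push Not at hc
            have := (h2.sign hF).2.mpr hc
            linarith
          · have := (h2.congr hF).2
            linarith
        rw [hcast] at hx1
        exact hnx (Or.inl (by simp; linarith))
      · subst heq
        obtain rfl := child_inj hpar hcadet.1
        rcases hAd' with ⟨h2, h3⟩ | h2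
        · subst h2
          refine ih k2 (by omega) hDk2 (Or.inr ⟨?_, hA, hk2i⟩)
          rcases hk with rfl | hk
          · exact h3
          · exact hk.1.trans h3
        · exfalso
          rcases hk with rfl | hk
          · rcases h2 with h2 | h2
            · exact hA h2
            · exact hC h2.1
          · have hj := jump hsym hclosed (x := y) i (s := 0) (t := t2) (child_ne hcadet.1)
              (by rw [Nat.zero_add]; exact h2)
            rcases hj with hj | hj
            · exact hk.2.1 (hj.symm_zero hsym)
            · exact hA hj

theorem first_diff {V : Type*} [Finite V] (lx ly : V → V → Prop)
    (hxi : ∀ a, ¬ lx a a) (hyi : ∀ a, ¬ ly a a)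
    (hxa : ∀ a b, lx a b → ¬ lx b a) (hya : ∀ a b, ly a b → ¬ ly b a)
    (hxt : ∀ a b, lx a b ∨ a = b ∨ lx b a) (hyt : ∀ a b, ly a b ∨ a = b ∨ ly b a)
    (wx : WellFounded lx) (wy : WellFounded ly) :
    (∀ a b, lx a b ↔ ly a b) ∨ ∃ D : Set V, (∀ a b, b ∈ D → lx a b → a ∈ D) ∧
      (∀ a b, b ∈ D → ly a b → a ∈ D) ∧ (∀ a ∈ D, ∀ b ∈ D, lx a b ↔ ly a b) ∧
      ∃ v w, v ∉ D ∧ w ∉ D ∧ v ≠ w ∧ (∀ a, a ∉ D → ¬ lx a v) ∧ (∀ a, a ∉ D → ¬ ly a w) := by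
  obtain ⟨D, ⟨h1, h2, h3⟩, hmax⟩ := (wellFounded_gt (α := Set V)).has_min
    {D : Set V | (∀ a b, b ∈ D → lx a b → a ∈ D) ∧
      (∀ a b, b ∈ D → ly a b → a ∈ D) ∧ (∀ a ∈ D, ∀ b ∈ D, (lx a b ↔ ly a b))}
    ⟨∅, by simp⟩
  by_cases hD : ∀ a, a ∈ D
  · left; exact fun a b => h3 a (hD a) b (hD b)
  · right
    push Not at hD
    obtain ⟨v, hv, hvm⟩ := wx.has_min Dᶜ hD
    obtain ⟨w, hw, hwm⟩ := wy.has_min Dᶜ hD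
    refine ⟨D, h1, h2, h3, v, w, hv, hw, ?_, fun a ha => hvm a ha, fun a ha => hwm a ha⟩
    rintro rfl
    refine hmax (insert v D) ⟨?_, ?_, ?_⟩ (Set.ssubset_insert hv)
    · rintro a b (rfl | hb) hab
      · right; by_contra ha; exact hvm a ha hab
      · right; exact h1 a b hb hab
    · rintro a b (rfl | hb) hab
      · right; by_contra ha; exact hwm a ha hab
      · right; exact h2 a b hb hab
    · have kx : ∀ a ∈ D, lx a v := by
        intro a ha
        rcases hxt a v with h | h | h
        · exact h
        · exact absurd (h ▸ ha) hv
        · exact absurd (h1 _ _ ha h) hv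
      have ky : ∀ a ∈ D, ly a v := by
        intro a ha
        rcases hyt a v with h | h | h
        · exact h
        · exact absurd (h ▸ ha) hv
        · exact absurd (h2 _ _ ha h) hv
      rintro a (rfl | ha) b (rfl | hb)
      · exact iff_of_false (hxi _) (hyi _)
      · exact iff_of_false (hxa _ _ (kx b hb)) (hya _ _ (ky b hb))
      · exact iff_of_true (kx a ha) (ky a ha)
      · exact h3 a ha b hb

theorem good_unique (hsym : ∀ s : ℤ, s ∈ S ↔ -s ∈ S)
    (hclosed : ∀ s t : ℕ, (s : ℤ) ∉ S → (t : ℤ) ∉ S → ((s : ℤ) + (t : ℤ)) ∉ S)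
    (hF : FEq S x y) (hgx : Gen m S x) (hgy : Gen m S y) {T T' : Tree m n}
    (hT : Comp T x) (hT' : Comp T' y) (hcx : CadX S T x) (hcy : CadX S T' y) :
    T = T' ∧ marks T x = marks T' y := by
  have tot : ∀ (x : Fin n → ℝ) (a b : Fin n × Fin (m + 1)),
      slt x a.1 a.2 b.1 b.2 ∨ a = b ∨ slt x b.1 b.2 a.1 a.2 := by
    intro x a b
    rcases slt_total (x := x) a.1 b.1 a.2 b.2 with h | h | h
    · exact Or.inl h
    · exact Or.inr (Or.inl (Prod.ext h.1 (Fin.ext h.2)))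
    · exact Or.inr (Or.inr h)
  have main : ∀ a b : Fin n × Fin (m + 1), slt x a.1 a.2 b.1 b.2 ↔ slt y a.1 a.2 b.1 b.2 := by
    rcases first_diff (V := Fin n × Fin (m + 1)) (fun a b => slt x a.1 a.2 b.1 b.2)
      (fun a b => slt y a.1 a.2 b.1 b.2) (fun _ => slt_irrefl _ _) (fun _ => slt_irrefl _ _)
      (fun _ _ h => slt_asymm h) (fun _ _ h => slt_asymm h) (tot x) (tot y)
      (wf_slots m x) (wf_slots m y) with h | ⟨D, h1, h2, h3, v, w, hv, hw, hvw, hvm, hwm⟩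
    · exact h
    exfalso
    let D' : Fin n → ℕ → Prop := fun a r => ∃ h : r < m + 1, (a, (⟨r, h⟩ : Fin (m + 1))) ∈ D
    have hD' : ∀ a : Fin n × Fin (m + 1), D' a.1 a.2 ↔ a ∈ D := by
      rintro ⟨a, r⟩
      exact ⟨fun ⟨_, h⟩ => h, fun h => ⟨r.2, h⟩⟩
    have dx : ∀ a r b q, r ≤ m → q ≤ m → D' b q → slt x a r b q → D' a r := by
      rintro a r b q hr hq ⟨hb, hD⟩ h
      exact ⟨by omega, h1 (a, ⟨r, by omega⟩) (b, ⟨q, hb⟩) hD h⟩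
    have dy : ∀ a r b q, r ≤ m → q ≤ m → D' b q → slt y a r b q → D' a r := by
      rintro a r b q hr hq ⟨hb, hD⟩ h
      exact ⟨by omega, h2 (a, ⟨r, by omega⟩) (b, ⟨q, hb⟩) hD h⟩
    have mv : ∀ a r, r ≤ m → ¬ D' a r → ¬ slt x a r v.1 v.2 := by
      intro a r hr ha
      exact hvm (a, ⟨r, by omega⟩) (fun h => ha ⟨by omega, h⟩)
    have mw : ∀ a r, r ≤ m → ¬ D' a r → ¬ slt y a r w.1 w.2 := by
      intro a r hr ha
      exact hwm (a, ⟨r, by omega⟩) (fun h => ha ⟨by omega, h⟩)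
    have hv' : ¬ D' v.1 v.2 := fun h => hv ((hD' v).mp h)
    have hw' : ¬ D' w.1 w.2 := fun h => hw ((hD' w).mp h)
    have bv : (v.2 : ℕ) ≤ m := by have := v.2.2; omega
    have bw : (w.2 : ℕ) ≤ m := by have := w.2.2; omega
    have step1 : (v.2 : ℕ) = 0 → (w.2 : ℕ) = 0 ∧ (w.1 = v.1 ∨ v.1 < w.1) := by
      intro h0
      refine core hsym hclosed hF.symm hgy hT' hcy D' dy (i := v.1) ?_ bw hw' mw _ v.1 le_rfl
        (by rw [← h0]; exact hv') (Or.inl rfl)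
      intro k t ht hk
      by_contra hc
      exact mv k t ht hc (by rw [h0]; exact hk)
    have step2 : (w.2 : ℕ) = 0 → (v.2 : ℕ) = 0 ∧ (v.1 = w.1 ∨ w.1 < v.1) := by
      intro h0
      refine core hsym hclosed hF hgx hT hcx D' dx (i := w.1) ?_ bv hv' mv _ w.1 le_rfl
        (by rw [← h0]; exact hw') (Or.inl rfl)
      intro k t ht hk
      by_contra hc
      exact mw k t ht hc (by rw [h0]; exact hk)
    have hne : (v.2 : ℕ) = 0 → (w.2 : ℕ) = 0 → v.1 ≠ w.1 := by
      intro e1 e2 e3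
      exact hvw (Prod.ext e3 (Fin.ext (e1.trans e2.symm)))
    by_cases e : (v.2 : ℕ) = 0 ∨ (w.2 : ℕ) = 0
    · have hv0 : (v.2 : ℕ) = 0 := by
        rcases e with e | e
        · exact e
        · exact (step2 e).1
      obtain ⟨hw0, h4⟩ := step1 hv0
      obtain ⟨_, h5⟩ := step2 hw0
      have h6 := hne hv0 hw0
      rcases h4 with h4 | h4
      · exact h6 h4.symm
      · rcases h5 with h5 | h5
        · exact h6 h5
        · exact lt_asymm h4 h5
    · push Not at e
      have sub1 : ∀ (x : Fin n → ℝ) (a : Fin n) (r : ℕ), 0 < r → slt x a (r - 1) a r := by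
        intro x a r hr
        left
        have : ((r - 1 : ℕ) : ℝ) < r := by exact_mod_cast (by omega : r - 1 < r)
        linarith
      have dv : D' v.1 (v.2 - 1) := by
        by_contra hc
        exact mv _ _ (by omega) hc (sub1 x _ _ (by omega))
      have dw : D' w.1 (w.2 - 1) := by
        by_contra hc
        exact mw _ _ (by omega) hc (sub1 y _ _ (by omega))
      have sx : slt x v.1 v.2 w.1 w.2 := by
        rcases tot x v w with h | h | h
        · exact h
        · exact absurd h hvw
        · exact absurd h (mv _ _ bw hw')
      have ev : ((v.2 : ℕ) - 1) + 1 = v.2 := by omega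
      have ew : ((w.2 : ℕ) - 1) + 1 = w.2 := by omega
      have sx' : slt x v.1 ((v.2 : ℕ) - 1) w.1 ((w.2 : ℕ) - 1) := by
        rw [← slt_add _ _ _ _ 1, ev, ew]; exact sx
      obtain ⟨bv', dv'⟩ := dv
      obtain ⟨bw', dw'⟩ := dw
      have sy' : slt y v.1 ((v.2 : ℕ) - 1) w.1 ((w.2 : ℕ) - 1) := (h3 _ dv' _ dw').mp sx'
      rw [← slt_add _ _ _ _ 1, ev, ew] at sy'
      exact mw _ _ bv hv' sy'
  have main' : ∀ a r b q, r ≤ m → q ≤ m → (slt x a r b q ↔ slt y a r b q) := by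
    intro a r b q hr hq
    exact main (a, ⟨r, by omega⟩) (b, ⟨q, by omega⟩)
  have hTy : Comp T y := by
    refine ⟨?_, ?_, ?_⟩
    · intro i hi j s hs
      rw [← main' _ _ _ _ hs (Nat.zero_le _)]
      exact hT.root i hi j s hs
    · intro i j s h
      rw [← main' _ _ _ _ (child_le h) (Nat.zero_le _)]
      exact hT.lt i j s h
    · intro i j s h k t ht
      rw [← main' _ _ _ _ ht (Nat.zero_le _), ← main' _ _ _ _ (child_le h) ht]
      exact hT.max i j s h k t ht
  have hTT : T = T' := hTy.tree_unique hT'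
  refine ⟨hTT, ?_⟩
  subst hTT
  ext i
  constructor
  · rintro ⟨j, s, h, he⟩
    refine ⟨j, s, h, ?_⟩
    have := ((hgx.conn (child_le h) he).congr hF).2
    linarith
  · rintro ⟨j, s, h, he⟩
    refine ⟨j, s, h, ?_⟩
    have := ((hgy.conn (child_le h) he).congr hF.symm).2
    linarith

end faces

section existence
variable {m n : ℕ} {S : Set ℤ} {x y z : Fin n → ℝ}

theorem perturb (m : ℕ) (z v : Fin n → ℝ) : ∃ η : ℝ, 0 < η ∧ ∀ a b : Fin n, ∀ k : ℤ, |k| ≤ m →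
    (z a - z b < k → (z a + η * v a) - (z b + η * v b) < k) ∧
    ((k : ℝ) < z a - z b → (k : ℝ) < (z a + η * v a) - (z b + η * v b)) := by
  have key : ∀ a b : Fin n, ∀ k : ℤ, ∀ᶠ η in nhdsWithin (0 : ℝ) (Set.Ioi 0),
      (z a - z b < k → (z a + η * v a) - (z b + η * v b) < k) ∧
      ((k : ℝ) < z a - z b → (k : ℝ) < (z a + η * v a) - (z b + η * v b)) := by
    intro a b k
    have ht : Filter.Tendsto (fun η : ℝ => (z a + η * v a) - (z b + η * v b))
        (nhdsWithin (0 : ℝ) (Set.Ioi 0)) (nhds (z a - z b)) := by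
      have hc : Continuous (fun η : ℝ => (z a + η * v a) - (z b + η * v b)) := by fun_prop
      have := (hc.tendsto 0).mono_left (nhdsWithin_le_nhds (s := Set.Ioi 0))
      simpa using this
    refine Filter.Eventually.and ?_ ?_
    · by_cases h : z a - z b < k
      · filter_upwards [ht.eventually_lt_const h] with η hη _ using hη
      · exact Filter.Eventually.of_forall fun _ h' => absurd h' h
    · by_cases h : (k : ℝ) < z a - z b
      · filter_upwards [ht.eventually_const_lt h] with η hη _ using hη
      · exact Filter.Eventually.of_forall fun _ h' => absurd h' h
  have hall : ∀ᶠ η in nhdsWithin (0 : ℝ) (Set.Ioi 0), ∀ a b : Fin n,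
      ∀ k ∈ Finset.Icc (-(m : ℤ)) m,
      (z a - z b < (k : ℤ) → (z a + η * v a) - (z b + η * v b) < (k : ℤ)) ∧
      (((k : ℤ) : ℝ) < z a - z b → ((k : ℤ) : ℝ) < (z a + η * v a) - (z b + η * v b)) := by
    rw [Filter.eventually_all]
    intro a
    rw [Filter.eventually_all]
    intro b
    rw [Filter.eventually_all_finset]
    intro k _
    exact key a b k
  obtain ⟨η, h1, h2⟩ := (hall.and self_mem_nhdsWithin).exists
  refine ⟨η, h2, fun a b k hk => h1 a b k ?_⟩
  rw [abs_le] at hk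
  exact Finset.mem_Icc.mpr hk

theorem Conn.sim (hS : ∀ s ∈ S, |s| ≤ (m : ℤ)) {T : Tree m n} (hT : Comp T x) {a b : Fin n}
    (h : Conn S x a b) : simMu T (marks T x) a b := by
  induction h with
  | refl => exact Relation.ReflTransGen.refl
  | tail _ hstep ih =>
    obtain ⟨s, hs, he⟩ := hstep
    exact sim_trans ih (hT.sim_of_int (hS s hs) he)

theorem Gen.sim_iff (hS : ∀ s ∈ S, |s| ≤ (m : ℤ)) {T : Tree m n} (hT : Comp T x)
    (hg : Gen m S x) (hsym : ∀ s : ℤ, s ∈ S ↔ -s ∈ S) {a b : Fin n} :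
    simMu T (marks T x) a b ↔ Conn S x a b := by
  refine ⟨fun h => ?_, fun h => h.sim hS hT⟩
  induction h with
  | refl => exact Relation.ReflTransGen.refl
  | tail _ hstep ih =>
    refine ih.trans ?_
    rcases hstep with ⟨h1, s, h2⟩ | ⟨h1, s, h2⟩
    · exact hg.conn (child_le h2) ((marks_child h2).mp h1)
    · exact (hg.conn (child_le h2) ((marks_child h2).mp h1)).symm hsym

theorem exists_generic (hsym : ∀ s : ℤ, s ∈ S ↔ -s ∈ S) (hS : ∀ s ∈ S, |s| ≤ (m : ℤ))
    (x : Fin n → ℝ) : ∃ y, FEq S x y ∧ Gen m S y := by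
  let st : Setoid (Fin n) := ⟨Conn S x, fun _ => Relation.ReflTransGen.refl,
    fun h => h.symm hsym, fun h h' => Relation.ReflTransGen.trans h h'⟩
  let v : Fin n → ℝ := fun a => (((Quotient.mk st a).out : Fin n) : ℕ)
  have hv : ∀ a b, v a = v b ↔ Conn S x a b := by
    intro a b
    simp only [v]
    rw [Nat.cast_inj, Fin.val_inj, Quotient.out_inj, Quotient.eq]
    rfl
  obtain ⟨η, h0, hη⟩ := perturb m x v
  have hF : FEq S x (fun a => x a + η * v a) := by
    intro a b s hs
    have h1 := hη a b s (hS s hs)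
    rcases lt_trichotomy (x a - x b) s with h | h | h
    · have := h1.1 h
      exact ⟨⟨fun h' => by linarith, fun h' => by simp only at h'; linarith⟩,
        ⟨fun _ => this, fun _ => h⟩⟩
    · have hc : v a = v b := (hv a b).mpr (Relation.ReflTransGen.single ⟨s, hs, h⟩)
      have : (x a + η * v a) - (x b + η * v b) = s := by rw [hc]; linarith
      exact ⟨⟨fun _ => this, fun _ => h⟩,
        ⟨fun h' => by linarith, fun h' => by simp only at h'; linarith⟩⟩
    · have := h1.2 h
      exact ⟨⟨fun h' => by linarith, fun h' => by simp only at h'; linarith⟩,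
        ⟨fun h' => by linarith, fun h' => by simp only at h'; linarith⟩⟩
  refine ⟨_, hF, ?_⟩
  intro a b k hk he
  simp only at he
  have h1 := hη a b k hk
  rcases lt_trichotomy (x a - x b) k with h | h | h
  · linarith [h1.1 h]
  · have : η * (v a - v b) = 0 := by linarith
    rcases mul_eq_zero.mp this with h' | h'
    · linarith
    · exact (((hv a b).mp (by linarith)).congr hF).1
  · linarith [h1.2 h]

/-- The number of slots below points. -/
noncomputable def level (m : ℕ) (x : Fin n → ℝ) : Finset (Fin n × Fin n × Fin (m + 1)) :=
  Finset.univ.filter fun p =>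
    (0 < (p.2.2 : ℕ) ∨ p.2.1 < p.1) ∧ x p.2.1 + (p.2.2 : ℕ) ≤ x p.1

theorem sim_mono {T : Tree m n} {μ ν : Set (Fin n)} (h : μ ⊆ ν) {a b : Fin n}
    (hs : simMu T μ a b) : simMu T ν a b := by
  unfold simMu at *
  induction hs with
  | refl => exact Relation.ReflTransGen.refl
  | tail _ hstep ih =>
    refine ih.tail ?_
    rcases hstep with h1 | h1
    · exact Or.inl ⟨h h1.1, h1.2⟩
    · exact Or.inr ⟨h h1.1, h1.2⟩

theorem improve (hsym : ∀ s : ℤ, s ∈ S ↔ -s ∈ S) (hS : ∀ s ∈ S, |s| ≤ (m : ℤ))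
    (hg : Gen m S x) {T : Tree m n} (hT : Comp T x) {i j : Fin n} {s : ℕ}
    (hc : T.IsCadet i j s) (hne : x i ≠ x j + s) (h0 : ¬ (s = 0 ∧ i < j))
    (hA : ¬ Ad S x i j s) :
    ∃ y, FEq S x y ∧ Gen m S y ∧ (level m y).card < (level m x).card := by
  have hij : i ≠ j := child_ne hc.1
  have hsm : s ≤ m := child_le hc.1
  have h0' : 0 < s ∨ j < i := by
    by_contra hcon
    push Not at hcon
    exact h0 ⟨by omega, lt_of_le_of_ne hcon.2 hij⟩
  have hμ : IsMarking T (insert i (marks T x)) := by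
    intro a ha
    rcases ha with rfl | ha
    · exact ⟨j, s, hc, fun h => by
        rcases h0' with h' | h'
        · omega
        · exact h'⟩
    · exact hT.isMarking a ha
  obtain ⟨z, hTz, hmz⟩ := realise hμ
  have nconn : ¬ Conn S x i j := by
    intro h
    have h1 := sim_drift (h.sim hS hT)
    have h2 := child_drift hc.1
    rw [h2] at h1
    push_cast at h1
    exact hne (by linarith)
  have hd : ∀ a b, Conn S x a b → z a - z b = x a - x b := by
    intro a b h
    have h1 := h.sim hS hT
    rw [sim_drift h1]
    exact sim_drift (hmz ▸ sim_mono (Set.subset_insert _ _) h1)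
  have hzij : z i = z j + s := (marks_child hc.1).mp (hmz ▸ Set.mem_insert _ _)
  have hR : ∀ a b, simMu T (marks T z) a b → Conn S x a b ∨ (Conn S x i a ∧ Conn S x j b) ∨
      (Conn S x j a ∧ Conn S x i b) := by
    intro a b h
    rw [hmz] at h
    have tr : ∀ a b c, Conn S x a b → Conn S x b c → Conn S x a c :=
      fun a b c h h' => Relation.ReflTransGen.trans h h'
    have sy : ∀ a b, Conn S x a b → Conn S x b a := fun a b h => h.symm hsym
    induction h with
    | refl => exact Or.inl Relation.ReflTransGen.refl
    | @tail b c _ hstep ih =>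
      have hstep' : Conn S x b c ∨ (b = i ∧ c = j) ∨ (b = j ∧ c = i) := by
        rcases hstep with ⟨h1, t, h2⟩ | ⟨h1, t, h2⟩
        · rcases h1 with rfl | h1
          · exact Or.inr (Or.inl ⟨rfl, (child_unique h2 hc.1).1⟩)
          · exact Or.inl (hg.conn (child_le h2) ((marks_child h2).mp h1))
        · rcases h1 with rfl | h1
          · exact Or.inr (Or.inr ⟨(child_unique h2 hc.1).1, rfl⟩)
          · exact Or.inl (sy _ _ (hg.conn (child_le h2) ((marks_child h2).mp h1)))
      have ri : Conn S x i i := Relation.ReflTransGen.refl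
      have rj : Conn S x j j := Relation.ReflTransGen.refl
      rcases hstep' with h1 | ⟨rfl, rfl⟩ | ⟨rfl, rfl⟩
      · rcases ih with h2 | ⟨h2, h3⟩ | ⟨h2, h3⟩
        · exact Or.inl (tr _ _ _ h2 h1)
        · exact Or.inr (Or.inl ⟨h2, tr _ _ _ h3 h1⟩)
        · exact Or.inr (Or.inr ⟨h2, tr _ _ _ h3 h1⟩)
      · rcases ih with h2 | ⟨h2, h3⟩ | ⟨h2, h3⟩
        · exact Or.inr (Or.inl ⟨sy _ _ h2, rj⟩)
        · exact absurd (sy _ _ h3) nconn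
        · exact Or.inl (sy _ _ h2)
      · rcases ih with h2 | ⟨h2, h3⟩ | ⟨h2, h3⟩
        · exact Or.inr (Or.inr ⟨sy _ _ h2, ri⟩)
        · exact Or.inl (sy _ _ h2)
        · exact absurd h3 nconn
  have hIJ : ∀ a b, Conn S x i a → Conn S x j b → ∀ r ∈ S, z a - z b ≠ (r : ℤ) := by
    intro a b ha hb r hr he
    refine hA ⟨a, b, ha, hb, r, hr, ?_⟩
    have e1 := hd _ _ ha
    have e2 := hd _ _ hb
    linarith
  have htie : ∀ a b, ∀ k : ℤ, |k| ≤ m → z a - z b = k → ¬ Conn S x a b →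
      (Conn S x i a ∧ Conn S x j b) ∨ (Conn S x j a ∧ Conn S x i b) := by
    intro a b k hk he hn
    exact (hR a b (hTz.sim_of_int hk he)).resolve_left hn
  let v : Fin n → ℝ := fun a => if Conn S x i a then -1 else 0
  have vi : ∀ a, Conn S x i a → v a = -1 := fun a h => if_pos h
  have vj : ∀ a, Conn S x j a → v a = 0 := fun a h => if_neg fun h' =>
    nconn (Relation.ReflTransGen.trans h' (h.symm hsym))
  have vc : ∀ a b, Conn S x a b → v a = v b := by
    intro a b h
    simp only [v]
    have : Conn S x i a ↔ Conn S x i b :=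
      ⟨fun h' => Relation.ReflTransGen.trans h' h,
        fun h' => Relation.ReflTransGen.trans h' (h.symm hsym)⟩
    simp only [this]
  obtain ⟨η, hη0, hη⟩ := perturb m z v
  have hord : ∀ a b, ∀ r : ℕ, r ≤ m → (0 < r ∨ a < b) → z a + r ≤ z b → x a + r ≤ x b := by
    intro a b r hr h h'
    exact slt_zero_le ((hTz.order_eq hT a b r hr).mp (slt_of_le h' h))
  have hord' : ∀ a b, ∀ r : ℕ, r ≤ m → (0 < r ∨ a < b) → x a + r ≤ x b → z a + r ≤ z b := by
    intro a b r hr h h'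
    exact slt_zero_le ((hT.order_eq hTz a b r hr).mp (slt_of_le h' h))
  have hnz : ∀ a b, ¬ Conn S x a b → ∀ r ∈ S, z a - z b ≠ (r : ℤ) := by
    intro a b hn r hr he
    rcases htie a b r (hS r hr) he hn with ⟨h1, h2⟩ | ⟨h1, h2⟩
    · exact hIJ a b h1 h2 r hr he
    · exact hIJ b a h2 h1 (-r) ((hsym r).mp hr) (by push_cast; linarith)
  have hnx : ∀ a b, ¬ Conn S x a b → ∀ r ∈ S, x a - x b ≠ (r : ℤ) := by
    intro a b hn r hr he
    exact hn (Relation.ReflTransGen.single ⟨r, hr, he⟩)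
  have hpos : ∀ a b, a ≠ b → ¬ Conn S x a b → ∀ r : ℕ, (r : ℤ) ∈ S →
      (x a - x b < (r : ℝ) ↔ z a - z b < (r : ℝ)) := by
    intro a b hab hn r hr
    have hrm : r ≤ m := by simpa using hS _ hr
    have n1 := hnz a b hn _ hr
    have n2 := hnx a b hn _ hr
    push_cast at n1 n2
    rcases Nat.eq_zero_or_pos r with rfl | h
    · rcases lt_or_gt_of_ne hab with h | h
      · have e1 := hord a b 0 hrm (Or.inr h)
        have e2 := hord' a b 0 hrm (Or.inr h)
        push_cast at *
        constructor
        · intro h3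
          exact lt_of_le_of_ne (by linarith [e2 (by linarith)]) n1
        · intro h3
          exact lt_of_le_of_ne (by linarith [e1 (by linarith)]) n2
      · have e1 := hord b a 0 hrm (Or.inr h)
        have e2 := hord' b a 0 hrm (Or.inr h)
        push_cast at *
        constructor
        · intro h3
          by_contra h4
          linarith [e1 (by linarith)]
        · intro h3
          by_contra h4
          linarith [e2 (by linarith)]
    · have e1 := hord b a r hrm (Or.inl h)
      have e2 := hord' b a r hrm (Or.inl h)
      constructor
      · intro h3
        by_contra h4
        linarith [e1 (by linarith)]
      · intro h3
        by_contra h4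
        linarith [e2 (by linarith)]
  have hsgn : ∀ a b, ¬ Conn S x a b → ∀ r ∈ S,
      (x a - x b < (r : ℤ) ↔ z a - z b < (r : ℤ)) := by
    intro a b hn r hr
    have hab : a ≠ b := fun h => hn (h ▸ Relation.ReflTransGen.refl)
    obtain ⟨t, rfl | rfl⟩ := Int.eq_nat_or_neg r
    · exact_mod_cast hpos a b hab hn t hr
    · have hn' : ¬ Conn S x b a := fun h => hn (h.symm hsym)
      have ht : (t : ℤ) ∈ S := (hsym _).mpr hr
      have h1 := hpos b a hab.symm hn' t ht
      have n1 := hnz b a hn' _ ht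
      have n2 := hnx b a hn' _ ht
      push_cast at *
      constructor
      · intro h3
        by_contra h4
        have : z b - z a < t := lt_of_le_of_ne (by linarith) n1
        linarith [h1.mpr this]
      · intro h3
        by_contra h4
        have : x b - x a < t := lt_of_le_of_ne (by linarith) n2
        linarith [h1.mp this]
  have hF : FEq S x (fun a => z a + η * v a) := by
    intro a b r hr
    by_cases hn : Conn S x a b
    · have e1 := hd a b hn
      have e2 := vc a b hn
      have : (z a + η * v a) - (z b + η * v b) = x a - x b := by rw [e2]; linarith
      simp only [this, and_self]
    · have n1 := hnz a b hn r hr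
      have n2 := hnx a b hn r hr
      have h1 := hη a b r (hS r hr)
      have h2 := hsgn a b hn r hr
      simp only
      rcases lt_or_gt_of_ne n1 with h | h
      · have h3 := h1.1 h
        exact ⟨⟨fun h' => absurd h' n2, fun h' => by linarith⟩, ⟨fun _ => h3, fun _ => h2.mpr h⟩⟩
      · have h3 := h1.2 h
        exact ⟨⟨fun h' => absurd h' n2, fun h' => by linarith⟩,
          ⟨fun h' => by linarith [h2.mp h'], fun h' => by linarith⟩⟩
  refine ⟨_, hF, ?_, ?_⟩
  · intro a b k hk he
    simp only at he
    have h1 := hη a b k hk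
    by_contra hn
    have hn' : ¬ Conn S x a b := fun h => hn (h.congr hF).1
    rcases lt_trichotomy (z a - z b) k with h | h | h
    · linarith [h1.1 h]
    · rcases htie a b k hk h hn' with ⟨h2, h3⟩ | ⟨h2, h3⟩
      · rw [vi a h2, vj b h3] at he; linarith
      · rw [vj a h2, vi b h3] at he; linarith
    · linarith [h1.2 h]
  · apply Finset.card_lt_card
    rw [Finset.ssubset_iff_of_subset]
    · refine ⟨(i, j, ⟨s, by omega⟩), ?_, ?_⟩
      · simp only [level, Finset.mem_filter, Finset.mem_univ, true_and]
        exact ⟨h0', slt_zero_le (hT.lt _ _ _ hc.1)⟩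
      · simp only [level, Finset.mem_filter, Finset.mem_univ, true_and, not_and]
        intro _
        rw [vi i Relation.ReflTransGen.refl, vj j Relation.ReflTransGen.refl]
        linarith
    · rintro ⟨a, b, r, hr⟩ h
      simp only [level, Finset.mem_filter, Finset.mem_univ, true_and] at h ⊢
      refine ⟨h.1, ?_⟩
      have h2 := h.2
      have hrm : r ≤ m := by omega
      by_cases hn : Conn S x a b
      · have e1 := hd a b hn
        rw [vc a b hn] at h2
        linarith
      · have h1 := hη a b r (by simpa using hrm)
        push_cast at h1
        refine hord b a r hrm h.1 ?_
        by_contra h3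
        linarith [h1.1 (by linarith)]

theorem exists_good (hsym : ∀ s : ℤ, s ∈ S ↔ -s ∈ S) (hS : ∀ s ∈ S, |s| ≤ (m : ℤ))
    (x : Fin n → ℝ) : ∃ y, FEq S x y ∧ Gen m S y ∧ ∃ T : Tree m n, Comp T y ∧ CadX S T y := by
  obtain ⟨y0, h1, h2⟩ := exists_generic hsym hS x
  have key : ∀ N : ℕ, ∀ y, FEq S x y → Gen m S y → (level m y).card = N →
      ∃ y, FEq S x y ∧ Gen m S y ∧ ∃ T : Tree m n, Comp T y ∧ CadX S T y := by
    intro N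
    induction N using Nat.strong_induction_on with
    | _ N ih =>
      intro y hF hg hN
      obtain ⟨T, hT⟩ := exists_tree m y
      by_cases hc : CadX S T y
      · exact ⟨y, hF, hg, T, hT, hc⟩
      · unfold CadX at hc
        push Not at hc
        obtain ⟨i, j, s, hcad, hne, h0, hA⟩ := hc
        obtain ⟨y', hF', hg', hlt⟩ := improve hsym hS hg hT hcad hne
          (fun h => absurd h.2 (not_lt.mpr (h0 h.1))) hA
        exact ih _ (hN ▸ hlt) y' (hF.trans hF') hg' rfl
  exact key _ y0 h1 h2 rfl

end existence

section link
variable {m n : ℕ} {S : Set ℤ} {x y z : Fin n → ℝ}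

theorem hyp_inj {i j i' j' : Fin n} {s s' : ℝ} (hij : i ≠ j) (h : hyp n i j s = hyp n i' j' s') :
    (i' = i ∧ j' = j ∧ s' = s) ∨ (i' = j ∧ j' = i ∧ s' = -s) := by
  have hm : ∀ y : Fin n → ℝ, y i - y j = s ↔ y i' - y j' = s' := fun y => Set.ext_iff.mp h y
  have hp : ∀ w : Fin n → ℝ, w i = w j → w i' = w j' := by
    intro w hw
    have h1 := (hm (Pi.single i s)).mp (by simp [Pi.single_apply, hij.symm])
    have h2 := (hm (Pi.single i s + w)).mp (by simp [Pi.single_apply, hij.symm, hw])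
    simp only [Pi.add_apply] at h2
    linarith
  have hne : i' ≠ j' := by
    rintro rfl
    have h1 := (hm (Pi.single i s)).mp (by simp [Pi.single_apply, hij.symm])
    have h2 := (hm (Pi.single i (s + 1))).mpr (by simpa using h1)
    simp [Pi.single_apply, hij.symm] at h2
  have hi : i' = i ∨ i' = j := by
    by_contra hcon
    push Not at hcon
    have := hp (Pi.single i' 1) (by simp [Pi.single_apply, hcon.1.symm, hcon.2.symm])
    simp [Pi.single_apply, hne.symm] at this
  have hj : j' = i ∨ j' = j := by
    by_contra hcon
    push Not at hcon
    have := hp (Pi.single j' 1) (by simp [Pi.single_apply, hcon.1.symm, hcon.2.symm])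
    simp [Pi.single_apply, hne] at this
  have h1 := (hm (Pi.single i s)).mp (by simp [Pi.single_apply, hij.symm])
  rcases hi with rfl | rfl <;> rcases hj with rfl | rfl
  · exact absurd rfl hne
  · left
    refine ⟨rfl, rfl, ?_⟩
    simpa [Pi.single_apply, hij.symm] using h1.symm
  · right
    refine ⟨rfl, rfl, ?_⟩
    simpa [Pi.single_apply, hij.symm] using h1.symm
  · exact absurd rfl hne

theorem mem_arr (hsym : ∀ s : ℤ, s ∈ S ↔ -s ∈ S) {a b : Fin n} {r : ℝ} :
    hyp n a b r ∈ arrS S n ↔ a ≠ b ∧ ∃ s ∈ S, r = (s : ℤ) := by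
  constructor
  · rintro ⟨i, j, s, hij, hs, he⟩
    rcases hyp_inj hij.ne he.symm with ⟨rfl, rfl, rfl⟩ | ⟨rfl, rfl, rfl⟩
    · exact ⟨hij.ne, s, hs, rfl⟩
    · exact ⟨hij.ne', -s, (hsym s).mp hs, by push_cast; rfl⟩
  · rintro ⟨hab, s, hs, rfl⟩
    rcases lt_or_gt_of_ne hab with h | h
    · exact ⟨a, b, s, h, hs, rfl⟩
    · refine ⟨b, a, -s, h, (hsym s).mp hs, ?_⟩
      ext y
      simp only [hyp, Set.mem_setOf_eq]
      push_cast
      constructor <;> intro h <;> linarith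

theorem aconn_iff (hsym : ∀ s : ℤ, s ∈ S ↔ -s ∈ S) (hS : ∀ s ∈ S, |s| ≤ (m : ℤ))
    {T : Tree m n} (hT : Comp T x) : AConnected (arrS S n) T (marks T x) ↔ Gen m S x := by
  constructor
  · intro h a b k hk he
    have hab := hT.sim_of_int hk he
    have h1 := h (blockOf T (marks T x) a) ⟨a, rfl⟩ a Relation.ReflTransGen.refl b hab
    clear hab he
    induction h1 with
    | refl => exact Relation.ReflTransGen.refl
    | @tail b c _ hstep ih =>
      obtain ⟨h1, h2, h3⟩ := hstep
      refine Relation.ReflTransGen.tail ih ?_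
      obtain ⟨_, s, hs, he⟩ := (mem_arr hsym).mp h3
      refine ⟨s, hs, ?_⟩
      rw [← he]
      exact sim_drift (sim_trans (sim_symm h1) h2)
  · rintro hg B ⟨i0, rfl⟩ i hi j hj
    have hij : Conn S x i j := (hg.sim_iff hS hT hsym).mp (sim_trans (sim_symm hi) hj)
    clear hj
    induction hij with
    | refl => exact Relation.ReflTransGen.refl
    | @tail b c hb hstep ih =>
      obtain ⟨s, hs, he⟩ := hstep
      by_cases hbc : b = c
      · exact hbc ▸ ih
      · have hbB : simMu T (marks T x) i0 b := sim_trans hi (Conn.sim hS hT hb)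
        have hcs : simMu T (marks T x) b c :=
          Conn.sim hS hT (Relation.ReflTransGen.single ⟨s, hs, he⟩)
        refine ih.tail ⟨hbB, sim_trans hbB hcs, (mem_arr hsym).mpr ⟨hbc, s, hs, ?_⟩⟩
        rw [← sim_drift hcs, he]

theorem cadet_iff (hsym : ∀ s : ℤ, s ∈ S ↔ -s ∈ S) (hS : ∀ s ∈ S, |s| ≤ (m : ℤ))
    {T : Tree m n} (hT : Comp T x) (hg : Gen m S x) :
    CadetCond (arrS S n) T (marks T x) ↔ CadX S T x := by
  refine forall_congr' fun i => forall_congr' fun j => forall_congr' fun s =>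
    forall_congr' fun hc => ?_
  rw [marks_child hc.1]
  refine forall_congr' fun hne => ?_
  refine or_congr Iff.rfl ?_
  refine exists_congr fun i' => exists_congr fun j' => ?_
  rw [hg.sim_iff hS hT hsym, hg.sim_iff hS hT hsym, mem_arr hsym]
  refine and_congr_right fun hi => and_congr_right fun hj => ?_
  have e1 := sim_drift (hi.sim hS hT)
  have e2 := sim_drift (hj.sim hS hT)
  have e3 : (T.drift i : ℝ) = T.drift j + s := by exact_mod_cast child_drift hc.1
  have e4 : (T.drift i' : ℝ) - T.drift j' = (x i' - x i) + s + (x j - x j') := by linarith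
  rw [e4]
  refine and_iff_right ?_
  rintro rfl
  have := sim_drift (sim_trans (hi.sim hS hT) (sim_symm (hj.sim hS hT)))
  exact hne (by linarith)

theorem mem_OT_iff (hsym : ∀ s : ℤ, s ∈ S ↔ -s ∈ S) (hS : ∀ s ∈ S, |s| ≤ (m : ℤ))
    {T : Tree m n} (hT : Comp T x) :
    (T, marks T x) ∈ OTset m n (arrS S n) ↔ Gen m S x ∧ CadX S T x := by
  constructor
  · rintro ⟨_, h1, h2⟩
    have hg := (aconn_iff hsym hS hT).mp h1
    exact ⟨hg, (cadet_iff hsym hS hT hg).mp h2⟩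
  · rintro ⟨hg, h2⟩
    exact ⟨hT.isMarking, (aconn_iff hsym hS hT).mpr hg, (cadet_iff hsym hS hT hg).mpr h2⟩

/-- The face containing a point. -/
def cell (S : Set ℤ) (x : Fin n → ℝ) : Set (Fin n → ℝ) := {y | FEq S x y}

theorem feq_of_lt (hsym : ∀ s : ℤ, s ∈ S ↔ -s ∈ S)
    (h : ∀ a b : Fin n, a < b → ∀ s ∈ S, (x a - x b = (s : ℝ) ↔ y a - y b = (s : ℝ)) ∧
      (x a - x b < (s : ℝ) ↔ y a - y b < (s : ℝ))) : FEq S x y := by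
  intro a b s hs
  rcases lt_trichotomy a b with hab | rfl | hab
  · exact h a b hab s hs
  · simp
  · have h1 := h b a hab (-s) ((hsym s).mp hs)
    push_cast at h1
    have e1 : ∀ w : Fin n → ℝ, w a - w b = s ↔ w b - w a = -s :=
      fun w => ⟨fun h => by linarith, fun h => by linarith⟩
    have e2 : ∀ w : Fin n → ℝ, w a - w b < s ↔ ¬ (w b - w a = -s) ∧ ¬ (w b - w a < -s) := by
      intro w
      constructor
      · intro h
        exact ⟨fun h' => by linarith, fun h' => by linarith⟩
      · rintro ⟨h1, h2⟩
        have := lt_of_le_of_ne (not_lt.mp h2) (Ne.symm h1)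
        linarith
    rw [e1, e1, e2, e2, h1.1, h1.2]
    exact ⟨Iff.rfl, Iff.rfl⟩

theorem side_mem {a b : Fin n} (hab : a ≠ b) {s : ℝ} {σ : Set (Fin n → ℝ)}
    (h : IsSideOf n σ (hyp n a b s)) (hx : x ∈ σ) :
    y ∈ σ ↔ (x a - x b = s ↔ y a - y b = s) ∧ (x a - x b < s ↔ y a - y b < s) := by
  have h3 : σ = {w | w a - w b = s} ∨ σ = {w | w a - w b < s} ∨ σ = {w | s < w a - w b} := by
    rcases h with rfl | ⟨i, j, r, he, h⟩
    · exact Or.inl rfl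
    · rcases hyp_inj hab he with ⟨rfl, rfl, rfl⟩ | ⟨rfl, rfl, rfl⟩
      · exact Or.inr h
      · right
        rcases h with rfl | rfl
        · right
          ext w
          simp only [Set.mem_setOf_eq]
          constructor <;> intro h <;> linarith
        · left
          ext w
          simp only [Set.mem_setOf_eq]
          constructor <;> intro h <;> linarith
  rcases h3 with rfl | rfl | rfl
  · simp only [Set.mem_setOf_eq] at hx ⊢
    constructor
    · intro h; rw [hx, h]; simp
    · rintro ⟨h, _⟩; exact h.mp hx
  · simp only [Set.mem_setOf_eq] at hx ⊢
    constructor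
    · intro h
      exact ⟨⟨fun h' => by linarith, fun h' => by linarith⟩, ⟨fun _ => h, fun _ => hx⟩⟩
    · rintro ⟨_, h⟩; exact h.mp hx
  · simp only [Set.mem_setOf_eq] at hx ⊢
    constructor
    · intro h
      exact ⟨⟨fun h' => by linarith, fun h' => by linarith⟩,
        ⟨fun h' => by linarith, fun h' => by linarith⟩⟩
    · rintro ⟨h1, h2⟩
      by_contra h3
      rcases (not_lt.mp h3).lt_or_eq with h4 | h4
      · linarith [h2.mpr h4]
      · linarith [h1.mpr h4]

theorem inter_eq_cell (hsym : ∀ s : ℤ, s ∈ S ↔ -s ∈ S)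
    {σ : Set (Fin n → ℝ) → Set (Fin n → ℝ)} (hσ : ∀ H ∈ arrS S n, IsSideOf n (σ H) H)
    (hx : ∀ H ∈ arrS S n, x ∈ σ H) : ⋂ H ∈ arrS S n, σ H = cell S x := by
  ext y
  simp only [Set.mem_iInter, cell, Set.mem_setOf_eq]
  constructor
  · intro h
    refine feq_of_lt hsym fun a b hab s hs => ?_
    have hH : hyp n a b (s : ℝ) ∈ arrS S n := ⟨a, b, s, hab, hs, rfl⟩
    exact (side_mem hab.ne (hσ _ hH) (hx _ hH)).mp (h _ hH)
  · rintro h _ ⟨a, b, s, hab, hs, rfl⟩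
    have hH : hyp n a b (s : ℝ) ∈ arrS S n := ⟨a, b, s, hab, hs, rfl⟩
    exact (side_mem hab.ne (hσ _ hH) (hx _ hH)).mpr (h a b s hs)

theorem isFace_iff (hsym : ∀ s : ℤ, s ∈ S ↔ -s ∈ S) {F : Set (Fin n → ℝ)} :
    IsFace n (arrS S n) F ↔ ∃ x, F = cell S x := by
  constructor
  · rintro ⟨⟨x, hx⟩, σ, hσ, rfl⟩
    refine ⟨x, inter_eq_cell hsym hσ ?_⟩
    simpa using hx
  · rintro ⟨x, rfl⟩
    have : ∀ H ∈ arrS S n, ∃ σ, IsSideOf n σ H ∧ x ∈ σ := by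
      rintro _ ⟨a, b, s, hab, hs, rfl⟩
      rcases lt_trichotomy (x a - x b) s with h | h | h
      · exact ⟨_, Or.inr ⟨a, b, s, rfl, Or.inl rfl⟩, h⟩
      · exact ⟨_, Or.inl rfl, h⟩
      · exact ⟨_, Or.inr ⟨a, b, s, rfl, Or.inr rfl⟩, h⟩
    choose! σ h1 h2 using this
    exact ⟨⟨x, FEq.refl S x⟩, σ, h1, (inter_eq_cell hsym h1 h2).symm⟩

theorem cell_eq_iff : cell S x = cell S y ↔ FEq S x y := by
  constructor
  · intro h
    have : y ∈ cell S x := h ▸ FEq.refl S y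
    exact this
  · intro h
    ext w
    exact ⟨fun h' => h.symm.trans h', fun h' => h.trans h'⟩

theorem faces_finite (hfin : S.Finite) (hsym : ∀ s : ℤ, s ∈ S ↔ -s ∈ S) (n : ℕ) :
    {F | IsFace n (arrS S n) F}.Finite := by
  have := hfin.to_subtype
  let f : (Fin n → ℝ) → (Fin n × Fin n × S → Prop × Prop) := fun x p =>
    (x p.1 - x p.2.1 = ((p.2.2 : ℤ) : ℝ), x p.1 - x p.2.1 < ((p.2.2 : ℤ) : ℝ))
  have hf : ∀ x y, f x = f y → FEq S x y := by
    intro x y h a b s hs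
    have := congrFun h (a, b, ⟨s, hs⟩)
    simp only [f, Prod.mk.injEq] at this
    exact ⟨iff_of_eq this.1, iff_of_eq this.2⟩
  have h1 : (Set.range f).Finite := Set.toFinite _
  refine (h1.image (fun g => {y | f y = g})).subset ?_
  intro F hF
  obtain ⟨x, rfl⟩ := (isFace_iff hsym).mp hF
  refine ⟨f x, ⟨x, rfl⟩, ?_⟩
  ext y
  constructor
  · intro h
    exact hf x y (Eq.symm h)
  · intro h
    funext p
    have h' := h p.1 p.2.1 p.2.2 p.2.2.2
    exact Prod.ext (propext h'.1).symm (propext h'.2).symm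

end link

section dimension
variable {m n : ℕ} {S : Set ℤ} {x y z : Fin n → ℝ}

/-- The setoid of connected points. -/
def connSetoid (hsym : ∀ s : ℤ, s ∈ S ↔ -s ∈ S) (x : Fin n → ℝ) : Setoid (Fin n) :=
  ⟨Conn S x, fun _ => Relation.ReflTransGen.refl,
    fun h => h.symm hsym, fun h h' => Relation.ReflTransGen.trans h h'⟩

theorem direction_cell (hsym : ∀ s : ℤ, s ∈ S ↔ -s ∈ S) (hS : ∀ s ∈ S, |s| ≤ (m : ℤ))
    (x : Fin n → ℝ) : (affineSpan ℝ (cell S x)).direction =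
      LinearMap.range (LinearMap.funLeft ℝ ℝ (Quotient.mk (connSetoid hsym x))) := by
  rw [direction_affineSpan]
  apply le_antisymm
  · unfold vectorSpan
    rw [Submodule.span_le]
    rintro _ ⟨y, hy, z, hz, rfl⟩
    have hc : ∀ a b, Conn S x a b → y a - z a = y b - z b := by
      intro a b h
      have h1 := (h.congr hy).2
      have h2 := (h.congr hz).2
      linarith
    refine ⟨Quotient.lift (s := connSetoid hsym x) (fun a => y a - z a) hc, ?_⟩
    funext a
    rfl
  · rintro _ ⟨w, rfl⟩
    set v := LinearMap.funLeft ℝ ℝ (Quotient.mk (connSetoid hsym x)) w with hv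
    have hvc : ∀ a b, Conn S x a b → v a = v b := by
      intro a b h
      simp only [hv, LinearMap.funLeft_apply]
      rw [Quotient.sound (s := connSetoid hsym x) (a := a) (b := b) h]
    obtain ⟨η, h0, hη⟩ := perturb m x v
    have hF : FEq S x (fun a => x a + η * v a) := by
      intro a b s hs
      have h1 := hη a b s (hS s hs)
      rcases lt_trichotomy (x a - x b) s with h | h | h
      · have := h1.1 h
        exact ⟨⟨fun h' => by linarith, fun h' => by simp only at h'; linarith⟩,
          ⟨fun _ => this, fun _ => h⟩⟩
      · have hc : v a = v b := hvc a b (Relation.ReflTransGen.single ⟨s, hs, h⟩)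
        have : (x a + η * v a) - (x b + η * v b) = s := by rw [hc]; linarith
        exact ⟨⟨fun _ => this, fun _ => h⟩,
          ⟨fun h' => by linarith, fun h' => by simp only at h'; linarith⟩⟩
      · have := h1.2 h
        exact ⟨⟨fun h' => by linarith, fun h' => by simp only at h'; linarith⟩,
          ⟨fun h' => by linarith, fun h' => by simp only at h'; linarith⟩⟩
    have hmem := vsub_mem_vectorSpan ℝ (show (fun a => x a + η * v a) ∈ cell S x from hF)
      (show x ∈ cell S x from FEq.refl S x)
    have := Submodule.smul_mem _ η⁻¹ hmem
    convert this using 1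
    funext a
    simp [h0.ne']

theorem faceDim_cell (hsym : ∀ s : ℤ, s ∈ S ↔ -s ∈ S) (hS : ∀ s ∈ S, |s| ≤ (m : ℤ))
    (x : Fin n → ℝ) : faceDim n (cell S x) = Nat.card (Quotient (connSetoid hsym x)) := by
  unfold faceDim
  rw [direction_cell hsym hS, LinearMap.finrank_range_of_inj
    (LinearMap.funLeft_injective_of_surjective _ _ _ Quotient.mk_surjective),
    Module.finrank_fintype_fun_eq_card, Nat.card_eq_fintype_card]

theorem blocks_card (hsym : ∀ s : ℤ, s ∈ S ↔ -s ∈ S) (hS : ∀ s ∈ S, |s| ≤ (m : ℤ))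
    {T : Tree m n} (hT : Comp T x) (hg : Gen m S x) :
    (blocksOf T (marks T x)).ncard = faceDim n (cell S x) := by
  rw [faceDim_cell hsym hS]
  have hrel : ∀ a b, Conn S x a b → blockOf T (marks T x) a = blockOf T (marks T x) b := by
    intro a b h
    have h' := h.sim hS hT
    ext c
    exact ⟨fun h1 => sim_trans (sim_symm h') h1, fun h1 => sim_trans h' h1⟩
  let f : Quotient (connSetoid hsym x) → Set (Fin n) :=
    Quotient.lift (s := connSetoid hsym x) (blockOf T (marks T x)) hrel
  have hf : Function.Injective f := by
    intro p q
    induction p using Quotient.inductionOn with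
    | _ a =>
    induction q using Quotient.inductionOn with
    | _ b =>
    intro h
    have h' : blockOf T (marks T x) a = blockOf T (marks T x) b := h
    have h2 : b ∈ blockOf T (marks T x) a := by
      rw [h']
      exact Relation.ReflTransGen.refl
    exact Quotient.sound (s := connSetoid hsym x) ((hg.sim_iff hS hT hsym).mp h2)
  have hr : blocksOf T (marks T x) = Set.range f := by
    ext B
    constructor
    · rintro ⟨i, rfl⟩
      exact ⟨Quotient.mk _ i, rfl⟩
    · rintro ⟨q, rfl⟩
      induction q using Quotient.inductionOn with
      | _ a => exact ⟨a, rfl⟩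
  rw [hr, ← Nat.card_coe_set_eq, Nat.card_range_of_injective hf]

theorem faceDim_le (F : Set (Fin n → ℝ)) : faceDim n F ≤ n := by
  unfold faceDim
  refine (Submodule.finrank_le _).trans ?_
  simp

theorem sum_faces (hfin : S.Finite) (hsym : ∀ s : ℤ, s ∈ S ↔ -s ∈ S) (n : ℕ) :
    ∑ k ∈ Finset.range (n + 1), (faceCount S n k : ℚ) • (Polynomial.X : Polynomial ℚ) ^ k =
      ∑ᶠ F ∈ {F | IsFace n (arrS S n) F}, (Polynomial.X : Polynomial ℚ) ^ faceDim n F := by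
  have hf := faces_finite hfin hsym n
  rw [finsum_mem_eq_finite_toFinset_sum _ hf,
    ← Finset.sum_fiberwise_of_maps_to (s := hf.toFinset) (t := Finset.range (n + 1))
      (g := faceDim n) (fun F _ => Finset.mem_range.mpr (Nat.lt_succ_of_le (faceDim_le F)))]
  refine Finset.sum_congr rfl fun k _ => ?_
  have hc : faceCount S n k = (hf.toFinset.filter fun F => faceDim n F = k).card := by
    unfold faceCount
    rw [← Nat.card_eq_finsetCard]
    refine Nat.card_congr (Equiv.subtypeEquivRight fun F => ?_)
    simp
  rw [Finset.sum_congr rfl (g := fun _ => (Polynomial.X : Polynomial ℚ) ^ k)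
    (fun F hF => by rw [(Finset.mem_filter.mp hF).2]), Finset.sum_const, hc, Nat.cast_smul_eq_nsmul]

theorem feq_of_marks (hsym : ∀ s : ℤ, s ∈ S ↔ -s ∈ S) (hS : ∀ s ∈ S, |s| ≤ (m : ℤ))
    {T : Tree m n} (hx : Comp T x) (hz : Comp T z) (hm : marks T x = marks T z) :
    FEq S x z := by
  have tie : ∀ a b, ∀ k : ℤ, |k| ≤ m → (x a - x b = k ↔ z a - z b = k) := by
    intro a b k hk
    constructor
    · intro h
      have h1 := hx.sim_of_int hk h
      have e1 := sim_drift h1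
      have e2 := sim_drift (hm ▸ h1 : simMu T (marks T z) a b)
      linarith
    · intro h
      have h1 := hz.sim_of_int hk h
      have e1 := sim_drift h1
      have e2 := sim_drift (hm.symm ▸ h1 : simMu T (marks T x) a b)
      linarith
  have ord : ∀ u w : Fin n → ℝ, Comp T u → Comp T w → ∀ a b, ∀ r : ℕ, r ≤ m →
      (0 < r ∨ a < b) → u a + r ≤ u b → w a + r ≤ w b := by
    intro u w hu hw a b r hr h h'
    exact slt_zero_le ((hu.order_eq hw a b r hr).mp (slt_of_le h' h))
  have one : ∀ u w : Fin n → ℝ, Comp T u → Comp T w →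
      (∀ a b, ∀ k : ℤ, |k| ≤ m → (u a - u b = k ↔ w a - w b = k)) →
      ∀ a b, a < b → ∀ r : ℤ, |r| ≤ m → u a - u b < r → w a - w b < r := by
    intro u w hu hw ht a b hab r hr h
    rcases le_or_gt r 0 with h0 | h0
    · obtain ⟨t, rfl⟩ := Int.exists_eq_neg_ofNat h0
      have htm : t ≤ m := by simpa using hr
      have h1 := ord u w hu hw a b t htm (Or.inr hab)
      push_cast at h
      have h2 := h1 (by linarith)
      have h3 : w a - w b ≠ ((-(t : ℤ) : ℤ) : ℝ) := fun h4 => by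
        have := (ht a b _ hr).mpr h4
        push_cast at this
        linarith
      refine lt_of_le_of_ne ?_ h3
      push_cast
      linarith
    · obtain ⟨t, rfl⟩ := Int.eq_ofNat_of_zero_le h0.le
      have htm : t ≤ m := by simpa using hr
      push_cast at h ⊢
      by_contra h2
      linarith [ord w u hw hu b a t htm (Or.inl (by omega)) (by linarith)]
  refine feq_of_lt hsym fun a b hab s hs => ⟨tie a b s (hS s hs), ?_, ?_⟩
  · exact one x z hx hz tie a b hab s (hS s hs)
  · exact one z x hz hx (fun a b k hk => (tie a b k hk).symm) a b hab s (hS s hs)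

theorem sum_trees (hsym : ∀ s : ℤ, s ∈ S ↔ -s ∈ S)
    (hclosed : ∀ s t : ℕ, (s : ℤ) ∉ S → (t : ℤ) ∉ S → ((s : ℤ) + (t : ℤ)) ∉ S)
    (hS : ∀ s ∈ S, |s| ≤ (m : ℤ)) (n : ℕ) :
    ∑ᶠ p ∈ OTset m n (arrS S n), (Polynomial.X : Polynomial ℚ) ^ (blocksOf p.1 p.2).ncard =
      ∑ᶠ F ∈ {F | IsFace n (arrS S n) F}, (Polynomial.X : Polynomial ℚ) ^ faceDim n F := by
  have hex : ∀ p : Tree m n × Set (Fin n), p ∈ OTset m n (arrS S n) →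
      ∃ x, Comp p.1 x ∧ marks p.1 x = p.2 := fun p hp => realise hp.1
  choose! ξ h1 h2 using hex
  have h3 : ∀ p ∈ OTset m n (arrS S n), Gen m S (ξ p) ∧ CadX S p.1 (ξ p) := by
    intro p hp
    refine (mem_OT_iff hsym hS (h1 p hp)).mp ?_
    rw [h2 p hp]
    exact hp
  refine finsum_mem_eq_of_bijOn (fun p => cell S (ξ p)) ⟨?_, ?_, ?_⟩ ?_
  · intro p _
    exact (isFace_iff hsym).mpr ⟨_, rfl⟩
  · intro p hp q hq he
    obtain ⟨e1, e2⟩ := good_unique hsym hclosed (cell_eq_iff.mp he) (h3 p hp).1 (h3 q hq).1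
      (h1 p hp) (h1 q hq) (h3 p hp).2 (h3 q hq).2
    rw [h2 p hp, h2 q hq] at e2
    exact Prod.ext e1 e2
  · intro F hF
    obtain ⟨x, rfl⟩ := (isFace_iff hsym).mp hF
    obtain ⟨y, hxy, hg, T, hT, hc⟩ := exists_good hsym hS x
    have hp : (T, marks T y) ∈ OTset m n (arrS S n) := (mem_OT_iff hsym hS hT).mpr ⟨hg, hc⟩
    refine ⟨_, hp, ?_⟩
    exact (cell_eq_iff.mpr (hxy.trans (feq_of_marks hsym hS hT (h1 _ hp) (h2 _ hp).symm))).symm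
  · intro p hp
    have := blocks_card hsym hS (h1 p hp) (h3 p hp).1
    rw [h2 p hp] at this
    rw [this]

end dimension

/-- Corollary 5.4. For a finite nonempty `S ⊂ ℤ` with `S = -S` and
`s+t ∉ S` for all `s,t ∈ ℕ∖S`, and `m = max S`, the face generating function satisfies
`F_S(x,u) = Σ_{(T,μ) ∈ ŌT(S)} u^{#blocks(μ)} x^{|T|}/|T|!`, stated coefficientwise in `x`. -/
theorem face_gf_tree_sum (S : Set ℤ) (hfin : S.Finite) (hne : S.Nonempty)
    (hsym : ∀ s : ℤ, s ∈ S ↔ -s ∈ S)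
    (hclosed : ∀ s t : ℕ, (s : ℤ) ∉ S → (t : ℤ) ∉ S → ((s : ℤ) + (t : ℤ)) ∉ S)
    (m : ℕ) (hmS : (m : ℤ) ∈ S) (hmax : ∀ s ∈ S, s ≤ (m : ℤ)) :
    ∀ n : ℕ,
      PowerSeries.coeff (R := Polynomial ℚ) n (FGF S) =
        Polynomial.C ((n.factorial : ℚ)⁻¹) *
          ∑ᶠ p ∈ OTset m n (arrS S n), Polynomial.X ^ (blocksOf p.1 p.2).ncard := by
  intro n
  have hS : ∀ s ∈ S, |s| ≤ (m : ℤ) := fun s hs =>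
    abs_le.mpr ⟨by linarith [hmax (-s) ((hsym s).mp hs)], hmax s hs⟩
  rw [FGF, PowerSeries.coeff_mk, sum_faces hfin hsym, sum_trees hsym hclosed hS]

end Braid
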